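/- arXiv:1606.06586 — 2 statements merged into one kernel-verified Lean document; each statement's English description precedes it below -/
import Mathlib

section
/- Let R > 0 and let γ be a rotation invariant measure on ℝⁿ with density f(|x|), f ∈ C²([0,∞)), and set A = ∫₀¹ t^{n−1} f(Rt) dt. Then the following are equivalent: (i) for every ψ ∈ C²(𝕊ⁿ⁻¹), the function g(s) = γ(K_s) along the family K(R,ψ,I) (where K_s has support function R + sψ) satisfies g''(0)·g(0) ≤ ((n−1)/n)(g'(0))²; (ii) for every ψ ∈ C²(𝕊ⁿ⁻¹): (A f(R)/|𝕊ⁿ⁻¹|)·((n−1)∫_{𝕊ⁿ⁻¹} ψ² du − ∫_{𝕊ⁿ⁻¹} |∇_σψ|² du) + (A R f'(R)/|𝕊ⁿ⁻¹|)·∫_{𝕊ⁿ⁻¹} ψ² du ≤ ((n−1)/n) f(R)² · ((1/|𝕊ⁿ⁻¹|) ∫_{𝕊ⁿ⁻¹} ψ du)². -/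
open MeasureTheory Metric Set Pointwise
open scoped ENNReal RealInnerProductSpace

noncomputable section

/-- The convex body determined by a function `f` on the sphere (the Wulff shape). -/
def bodyOf {n : ℕ} (f : EuclideanSpace ℝ (Fin n) → ℝ) : Set (EuclideanSpace ℝ (Fin n)) :=
  {x | ∀ u ∈ sphere (0 : EuclideanSpace ℝ (Fin n)) 1, ⟪x, u⟫ ≤ f u}

/-- The spherical gradient of `ψ` at a unit vector `u`: the tangential component of the
ambient gradient. -/
def sphGrad {n : ℕ} (ψ : EuclideanSpace ℝ (Fin n) → ℝ) (u : EuclideanSpace ℝ (Fin n)) :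
    EuclideanSpace ℝ (Fin n) :=
  gradient ψ u - ⟪gradient ψ u, u⟫ • u

section RadialFunction

open Filter Topology

local notation "𝔼" n => EuclideanSpace ℝ (Fin n)

/-- The hyperplane with unit normal `v` supports the Wulff shape of `h` at the boundary point
`ρ • u`. -/
structure IsTouching {n : ℕ} (h : (𝔼 n) → ℝ) (u : 𝔼 n) (ρ : ℝ) (v : 𝔼 n) : Prop where
  norm_eq : ‖v‖ = 1
  pos : 0 < ρ
  eq : h v = ρ * ⟪u, v⟫
  le : ∀ w : 𝔼 n, ‖w‖ = 1 → ρ * ⟪u, w⟫ ≤ h w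

theorem exists_isTouching {n : ℕ} {h : (𝔼 n) → ℝ} (hc : Continuous h)
    (hpos : ∀ w : 𝔼 n, ‖w‖ = 1 → 0 < h w) {u : 𝔼 n} (hu : ‖u‖ = 1) :
    ∃ ρ v, IsTouching h u ρ v := by
  have hcont : ContinuousOn (fun w : 𝔼 n => ⟪u, w⟫ / h w) (sphere 0 1) :=
    ContinuousOn.div (by fun_prop) hc.continuousOn fun w hw =>
      (hpos w (by simpa using hw)).ne'
  obtain ⟨v, hv, hmax⟩ := (isCompact_sphere (0 : 𝔼 n) 1).exists_isMaxOn ⟨u, by simpa⟩ hcont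
  have hv1 : ‖v‖ = 1 := by simpa using hv
  have hle : ∀ w : 𝔼 n, ‖w‖ = 1 → ⟪u, w⟫ / h w ≤ ⟪u, v⟫ / h v := fun w hw =>
    hmax (show w ∈ sphere (0 : 𝔼 n) 1 by simpa)
  have h0 : 0 < ⟪u, v⟫ / h v := by
    refine lt_of_lt_of_le ?_ (hle u hu)
    rw [real_inner_self_eq_norm_sq, hu]
    have := hpos u hu
    positivity
  have hv0 := hpos v hv1
  have huv : 0 < ⟪u, v⟫ := by
    have := mul_pos h0 hv0
    rwa [div_mul_cancel₀ _ hv0.ne'] at this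
  refine ⟨h v / ⟪u, v⟫, v, hv1, by positivity, by field_simp, fun w hw => ?_⟩
  have h1 := hle w hw
  rw [div_le_div_iff₀ (hpos w hw) hv0] at h1
  rw [div_mul_eq_mul_div, div_le_iff₀ huv]
  linarith

theorem IsTouching.inner_pos {n : ℕ} {h : (𝔼 n) → ℝ} {u v : 𝔼 n} {ρ : ℝ}
    (H : IsTouching h u ρ v) (hpos : ∀ w : 𝔼 n, ‖w‖ = 1 → 0 < h w) : 0 < ⟪u, v⟫ := by
  have h1 := hpos v H.norm_eq
  rw [H.eq] at h1
  exact (pos_iff_pos_of_mul_pos h1).1 H.pos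

theorem IsTouching.smul_mem_bodyOf_iff {n : ℕ} {h : (𝔼 n) → ℝ} {u v : 𝔼 n} {ρ : ℝ}
    (H : IsTouching h u ρ v) (hpos : ∀ w : 𝔼 n, ‖w‖ = 1 → 0 < h w) {r : ℝ} (hr : 0 ≤ r) :
    r • u ∈ bodyOf h ↔ r ≤ ρ := by
  have huv := H.inner_pos hpos
  simp only [bodyOf, mem_ofPred_eq, mem_sphere_zero_iff_norm, real_inner_smul_left]
  constructor
  · intro hm
    have := hm v H.norm_eq
    rw [H.eq] at this
    exact le_of_mul_le_mul_right this huv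
  · intro hrρ w hw
    rcases le_total 0 ⟪u, w⟫ with h0 | h0
    · exact (mul_le_mul_of_nonneg_right hrρ h0).trans (H.le w hw)
    · exact (mul_nonpos_of_nonneg_of_nonpos hr h0).trans (hpos w hw).le

/-- The gradient of the one-homogeneous extension of `ψ` from the sphere, at a unit vector `v`. -/
def homGrad {n : ℕ} (ψ : (𝔼 n) → ℝ) (v : 𝔼 n) : 𝔼 n := sphGrad ψ v + ψ v • v

theorem inner_eq_zero_of_sphere_min {n : ℕ} {k : (𝔼 n) → ℝ} {v g : 𝔼 n} (hv : ‖v‖ = 1)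
    (hk : HasGradientAt k g v) (hmin : ∀ w : 𝔼 n, ‖w‖ = 1 → k v ≤ k w) {w : 𝔼 n}
    (hw : ‖w‖ = 1) (hvw : ⟪v, w⟫ = 0) : ⟪g, w⟫ = 0 := by
  have hd : HasDerivAt (fun θ : ℝ => Real.cos θ • v + Real.sin θ • w) w 0 := by
    have := ((Real.hasDerivAt_cos 0).smul_const v).add ((Real.hasDerivAt_sin 0).smul_const w)
    simpa using! this
  have hk' : HasFDerivAt k (InnerProductSpace.toDual ℝ _ g)
      ((fun θ : ℝ => Real.cos θ • v + Real.sin θ • w) 0) := by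
    simpa using! hk.hasFDerivAt
  have hcomp := hk'.comp_hasDerivAt 0 hd
  have hloc : IsLocalMin (k ∘ fun θ : ℝ => Real.cos θ • v + Real.sin θ • w) 0 := by
    refine Eventually.of_forall fun θ => ?_
    have : ‖Real.cos θ • v + Real.sin θ • w‖ = 1 := by
      rw [← sq_eq_sq₀ (norm_nonneg _) zero_le_one, norm_add_sq_real]
      simp [norm_smul, real_inner_smul_left, real_inner_smul_right, hvw, hv, hw]
    simpa using hmin _ this
  simpa using! hloc.hasDerivAt_eq_zero hcomp

theorem inner_sphGrad_self {n : ℕ} (ψ : (𝔼 n) → ℝ) {v : 𝔼 n} (hv : ‖v‖ = 1) :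
    ⟪v, sphGrad ψ v⟫ = 0 := by
  simp [sphGrad, inner_sub_right, real_inner_smul_right, hv]

theorem inner_gradient_sphGrad {n : ℕ} (ψ : (𝔼 n) → ℝ) {v : 𝔼 n} (hv : ‖v‖ = 1) :
    ⟪gradient ψ v, sphGrad ψ v⟫ = ‖sphGrad ψ v‖ ^ 2 := by
  have h : gradient ψ v = sphGrad ψ v + ⟪gradient ψ v, v⟫ • v := by simp [sphGrad]
  rw [← real_inner_self_eq_norm_sq]
  conv_lhs => rw [h]
  rw [inner_add_left, real_inner_smul_left, inner_sphGrad_self ψ hv, mul_zero, add_zero]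

theorem IsTouching.smul_eq {n : ℕ} {ψ : (𝔼 n) → ℝ} (hψ : Differentiable ℝ ψ) {R s : ℝ}
    {u v : 𝔼 n} {ρ : ℝ} (H : IsTouching (fun w => R + s * ψ w) u ρ v) :
    R • v + s • homGrad ψ v = ρ • u := by
  have hv := H.norm_eq
  set p : 𝔼 n := s • gradient ψ v - ρ • u with hp
  have hgrad : HasGradientAt (fun w => R + s * ψ w - ρ * ⟪u, w⟫) p v := by
    rw [hasGradientAt_iff_hasFDerivAt]
    have h1 := ((hψ v).hasGradientAt.hasFDerivAt.const_mul s).const_add R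
    have h2 : HasFDerivAt (fun w => ρ * ⟪u, w⟫) (ρ • innerSL ℝ u) v :=
      (innerSL ℝ u).hasFDerivAt.const_mul ρ
    convert! h1.sub h2 using 1
    ext w
    simp [hp]
  have hmin : ∀ w : 𝔼 n, ‖w‖ = 1 →
      R + s * ψ v - ρ * ⟪u, v⟫ ≤ R + s * ψ w - ρ * ⟪u, w⟫ := fun w hw => by
    have h1 := H.le w hw
    have h2 := H.eq
    linarith
  have htan : p - ⟪p, v⟫ • v = 0 := by
    by_contra hne
    set q := p - ⟪p, v⟫ • v with hq
    have hq0 : ‖q‖ ≠ 0 := norm_ne_zero_iff.2 hne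
    have hvq : ⟪v, q⟫ = 0 := by
      simp [hq, inner_sub_right, real_inner_smul_right, hv, real_inner_comm]
    have := inner_eq_zero_of_sphere_min hv hgrad hmin (w := ‖q‖⁻¹ • q)
      (by simp [norm_smul, hq0]) (by simp [real_inner_smul_right, hvq])
    rw [real_inner_smul_right, mul_eq_zero, or_iff_right (inv_ne_zero hq0)] at this
    have h3 : p = q + ⟪p, v⟫ • v := by simp [hq]
    rw [h3, inner_add_left, real_inner_smul_left, hvq, mul_zero, add_zero,
      real_inner_self_eq_norm_sq] at this
    exact hq0 (by simpa using this)
  have hpv : ⟪p, v⟫ = s * ⟪gradient ψ v, v⟫ - (R + s * ψ v) := by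
    have h2 := H.eq
    rw [h2, hp, inner_sub_left, real_inner_smul_left, real_inner_smul_left]
  rw [hpv, hp] at htan
  rw [← sub_eq_zero, ← htan, homGrad, sphGrad]
  module

/-- Uniform bounds on the sphere for a `C²` function and its homogeneous gradient. -/
structure HomGradBound {n : ℕ} (ψ : (𝔼 n) → ℝ) (C : ℝ) : Prop where
  pos : 0 < C
  abs_le : ∀ v : 𝔼 n, ‖v‖ = 1 → |ψ v| ≤ C
  abs_sub_le : ∀ v w : 𝔼 n, ‖v‖ = 1 → ‖w‖ = 1 → |ψ v - ψ w| ≤ C * ‖v - w‖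
  norm_le : ∀ v : 𝔼 n, ‖v‖ = 1 → ‖homGrad ψ v‖ ≤ C
  norm_sub_le : ∀ v w : 𝔼 n, ‖v‖ = 1 → ‖w‖ = 1 →
    ‖homGrad ψ v - homGrad ψ w‖ ≤ C * ‖v - w‖

theorem ContDiff.exists_lipschitz_closedBall {E F : Type*} [NormedAddCommGroup E]
    [NormedSpace ℝ E] [FiniteDimensional ℝ E] [NormedAddCommGroup F] [NormedSpace ℝ F]
    {g : E → F} (hg : ContDiff ℝ 1 g) (r : ℝ) :
    ∃ C : ℝ, 0 < C ∧ (∀ x ∈ closedBall (0 : E) r, ‖g x‖ ≤ C) ∧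
      ∀ x ∈ closedBall (0 : E) r, ∀ y ∈ closedBall (0 : E) r, ‖g x - g y‖ ≤ C * ‖x - y‖ := by
  obtain ⟨a, ha⟩ := (isCompact_closedBall (0 : E) r).exists_bound_of_continuousOn
    hg.continuous.continuousOn
  obtain ⟨b, hb⟩ := (isCompact_closedBall (0 : E) r).exists_bound_of_continuousOn
    (hg.continuous_fderiv one_ne_zero).continuousOn
  refine ⟨max 1 (max a b), by positivity, fun x hx => (ha x hx).trans (by simp), ?_⟩
  intro x hx y hy
  refine (convex_closedBall (0 : E) r).norm_image_sub_le_of_norm_fderiv_le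
    (fun z _ => (hg.differentiable one_ne_zero).differentiableAt)
    (fun z hz => (hb z hz).trans (by simp)) hy hx

theorem contDiff_gradient {n : ℕ} {ψ : (𝔼 n) → ℝ} (hψ : ContDiff ℝ 2 ψ) :
    ContDiff ℝ 1 (gradient ψ) :=
  (InnerProductSpace.toDual ℝ (𝔼 n)).symm.toContinuousLinearEquiv.contDiff.comp
    (hψ.fderiv_right (m := 1) (by norm_num))

theorem contDiff_sphGrad {n : ℕ} {ψ : (𝔼 n) → ℝ} (hψ : ContDiff ℝ 2 ψ) :
    ContDiff ℝ 1 (sphGrad ψ) := by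
  have := contDiff_gradient hψ
  unfold sphGrad
  exact this.sub ((this.inner ℝ contDiff_id).smul contDiff_id)

theorem exists_homGradBound {n : ℕ} {ψ : (𝔼 n) → ℝ} (hψ : ContDiff ℝ 2 ψ) :
    ∃ C, HomGradBound ψ C := by
  have h1 : ContDiff ℝ 1 ψ := hψ.of_le (by norm_num)
  have h2 : ContDiff ℝ 1 (homGrad ψ) := (contDiff_sphGrad hψ).add (h1.smul contDiff_id)
  obtain ⟨a, ha, ha1, ha2⟩ := h1.exists_lipschitz_closedBall 1
  obtain ⟨b, hb, hb1, hb2⟩ := h2.exists_lipschitz_closedBall 1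
  have hmem : ∀ v : 𝔼 n, ‖v‖ = 1 → v ∈ closedBall (0 : 𝔼 n) 1 := fun v hv => by simp [hv]
  refine ⟨max a b, by positivity, fun v hv => (ha1 v (hmem v hv)).trans (le_max_left _ _),
    fun v w hv hw => (ha2 v (hmem v hv) w (hmem w hw)).trans ?_,
    fun v hv => (hb1 v (hmem v hv)).trans (le_max_right _ _),
    fun v w hv hw => (hb2 v (hmem v hv) w (hmem w hw)).trans ?_⟩
  · gcongr
    exact le_max_left _ _
  · gcongr
    exact le_max_right _ _

theorem HomGradBound.add_mul_pos {n : ℕ} {ψ : (𝔼 n) → ℝ} {C R s : ℝ} (hC : HomGradBound ψ C)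
    (hs : |s| * (4 * C) < R) {w : 𝔼 n} (hw : ‖w‖ = 1) : 0 < R + s * ψ w := by
  have h1 : |s * ψ w| ≤ |s| * C := by
    rw [abs_mul]
    exact mul_le_mul_of_nonneg_left (hC.abs_le w hw) (abs_nonneg s)
  have h2 := neg_abs_le (s * ψ w)
  nlinarith [mul_nonneg (abs_nonneg s) hC.pos.le]

theorem IsTouching.half_le_inner {n : ℕ} {ψ : (𝔼 n) → ℝ} {C R s : ℝ} (hC : HomGradBound ψ C)
    (hs : |s| * (4 * C) < R) {u v : 𝔼 n} (hu : ‖u‖ = 1) {ρ : ℝ}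
    (H : IsTouching (fun w => R + s * ψ w) u ρ v) : 1 / 2 ≤ ⟪u, v⟫ := by
  have huv := H.inner_pos fun w hw => hC.add_mul_pos hs hw
  have huv1 : ⟪u, v⟫ ≤ 1 := by
    simpa [hu, H.norm_eq] using real_inner_le_norm u v
  have h1 := H.le u hu
  have h2 := H.eq
  rw [real_inner_self_eq_norm_sq, hu] at h1
  have h3 : R + s * ψ v ≤ (R + s * ψ u) * ⟪u, v⟫ := by
    rw [h2]
    gcongr
    linarith
  have h4 : |s * ψ u| ≤ |s| * C := by
    rw [abs_mul]
    exact mul_le_mul_of_nonneg_left (hC.abs_le u hu) (abs_nonneg s)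
  have h5 : |s * ψ v| ≤ |s| * C := by
    rw [abs_mul]
    exact mul_le_mul_of_nonneg_left (hC.abs_le v H.norm_eq) (abs_nonneg s)
  have h6 := abs_le.1 h4
  have h7 := abs_le.1 h5
  have hsC := mul_nonneg (abs_nonneg s) hC.pos.le
  have h8 : s * ψ u * ⟪u, v⟫ ≤ |s| * C := by nlinarith
  by_contra hlt
  push Not at hlt
  nlinarith

/-- The slope in `s` of the radial function at a touching point. -/
def touchSlope {n : ℕ} (ψ : (𝔼 n) → ℝ) (u v : 𝔼 n) : ℝ := ψ v / ⟪u, v⟫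

theorem IsTouching.abs_touchSlope_le {n : ℕ} {ψ : (𝔼 n) → ℝ} {C R s : ℝ}
    (hC : HomGradBound ψ C) (hs : |s| * (4 * C) < R) {u v : 𝔼 n} (hu : ‖u‖ = 1) {ρ : ℝ}
    (H : IsTouching (fun w => R + s * ψ w) u ρ v) : |touchSlope ψ u v| ≤ 2 * C := by
  have h1 := H.half_le_inner hC hs hu
  have h2 := hC.abs_le v H.norm_eq
  rw [touchSlope, abs_div, abs_of_pos (by linarith : 0 < ⟪u, v⟫), div_le_iff₀ (by linarith)]
  nlinarith [hC.pos]

theorem IsTouching.sub_le {n : ℕ} {ψ : (𝔼 n) → ℝ} {R s t : ℝ} {u v v' : 𝔼 n} {ρ ρ' : ℝ}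
    (H : IsTouching (fun w => R + s * ψ w) u ρ v) (huv : 0 < ⟪u, v⟫)
    (H' : IsTouching (fun w => R + t * ψ w) u ρ' v') :
    ρ' - ρ ≤ (t - s) * touchSlope ψ u v := by
  have h1 := H.eq
  have h2 := H'.le v H.norm_eq
  rw [touchSlope, ← mul_div_assoc, le_div_iff₀ huv]
  linarith

theorem IsTouching.abs_sub_le {n : ℕ} {ψ : (𝔼 n) → ℝ} {C R s t : ℝ}
    (hC : HomGradBound ψ C) (hs : |s| * (4 * C) < R) (ht : |t| * (4 * C) < R)
    {u v v' : 𝔼 n} (hu : ‖u‖ = 1) {ρ ρ' : ℝ}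
    (H : IsTouching (fun w => R + s * ψ w) u ρ v)
    (H' : IsTouching (fun w => R + t * ψ w) u ρ' v') :
    |ρ' - ρ| ≤ 2 * C * |t - s| := by
  have h1 := H.sub_le (by linarith [H.half_le_inner hC hs hu]) H'
  have h2 := H'.sub_le (by linarith [H'.half_le_inner hC ht hu]) H
  have h3 : |(t - s) * touchSlope ψ u v| ≤ 2 * C * |t - s| := by
    rw [abs_mul, mul_comm]
    exact mul_le_mul_of_nonneg_right (H.abs_touchSlope_le hC hs hu) (abs_nonneg _)
  have h4 : |(s - t) * touchSlope ψ u v'| ≤ 2 * C * |t - s| := by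
    rw [abs_mul, mul_comm, abs_sub_comm s t]
    exact mul_le_mul_of_nonneg_right (H'.abs_touchSlope_le hC ht hu) (abs_nonneg _)
  rw [abs_le]
  constructor
  · linarith [le_abs_self ((s - t) * touchSlope ψ u v')]
  · linarith [le_abs_self ((t - s) * touchSlope ψ u v)]

theorem IsTouching.norm_sub_le {n : ℕ} {ψ : (𝔼 n) → ℝ} (hψ : Differentiable ℝ ψ) {C R s t : ℝ}
    (hC : HomGradBound ψ C) (hR : 0 < R) (hs : |s| * (4 * C) < R) (ht : |t| * (4 * C) < R)
    {u v v' : 𝔼 n} (hu : ‖u‖ = 1) {ρ ρ' : ℝ}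
    (H : IsTouching (fun w => R + s * ψ w) u ρ v)
    (H' : IsTouching (fun w => R + t * ψ w) u ρ' v') :
    ‖v' - v‖ ≤ 4 * C / R * |t - s| := by
  have h1 := H.smul_eq hψ
  have h2 := H'.smul_eq hψ
  have h3 : R • (v' - v) = (ρ' - ρ) • u - (s • (homGrad ψ v' - homGrad ψ v)
      + (t - s) • homGrad ψ v') := by
    rw [sub_smul, ← h1, ← h2]
    module
  have h4 : R * ‖v' - v‖ ≤ |ρ' - ρ| + (|s| * (C * ‖v' - v‖) + |t - s| * C) := by
    calc R * ‖v' - v‖ = ‖R • (v' - v)‖ := by rw [norm_smul, Real.norm_of_nonneg hR.le]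
      _ ≤ ‖(ρ' - ρ) • u‖ + (‖s • (homGrad ψ v' - homGrad ψ v)‖ + ‖(t - s) • homGrad ψ v'‖) := by
        rw [h3]
        exact (_root_.norm_sub_le _ _).trans (add_le_add_right (norm_add_le _ _) _)
      _ ≤ _ := by
        simp only [norm_smul, hu, mul_one, Real.norm_eq_abs]
        gcongr
        · exact hC.norm_sub_le _ _ H'.norm_eq H.norm_eq
        · exact hC.norm_le _ H'.norm_eq
  have h5 := H.abs_sub_le hC hs ht hu H'
  rw [div_mul_eq_mul_div, le_div_iff₀ hR]
  nlinarith [norm_nonneg (v' - v)]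

theorem IsTouching.abs_touchSlope_sub_le {n : ℕ} {ψ : (𝔼 n) → ℝ} (hψ : Differentiable ℝ ψ)
    {C R s t : ℝ} (hC : HomGradBound ψ C) (hR : 0 < R) (hs : |s| * (4 * C) < R)
    (ht : |t| * (4 * C) < R) {u v v' : 𝔼 n} (hu : ‖u‖ = 1) {ρ ρ' : ℝ}
    (H : IsTouching (fun w => R + s * ψ w) u ρ v)
    (H' : IsTouching (fun w => R + t * ψ w) u ρ' v') :
    |touchSlope ψ u v' - touchSlope ψ u v| ≤ 6 * C * (4 * C / R) * |t - s| := by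
  have h0 := H.norm_sub_le hψ hC hR hs ht hu H'
  have h1 := H.half_le_inner hC hs hu
  have h3 := H'.abs_touchSlope_le hC ht hu
  have h4 := hC.abs_sub_le v' v H'.norm_eq H.norm_eq
  have h5 : |⟪u, v'⟫ - ⟪u, v⟫| ≤ ‖v' - v‖ := by
    rw [← inner_sub_right]
    simpa [hu] using abs_real_inner_le_norm u (v' - v)
  have h2 := H'.half_le_inner hC ht hu
  have hne : ⟪u, v⟫ ≠ 0 := by linarith
  have hne' : ⟪u, v'⟫ ≠ 0 := by linarith
  have h6 : (touchSlope ψ u v' - touchSlope ψ u v) * ⟪u, v⟫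
      = (ψ v' - ψ v) - touchSlope ψ u v' * (⟪u, v'⟫ - ⟪u, v⟫) := by
    rw [touchSlope, touchSlope]
    field_simp
    ring
  have h7 : |touchSlope ψ u v' - touchSlope ψ u v| * ⟪u, v⟫ ≤ 3 * C * ‖v' - v‖ := by
    rw [← abs_of_pos (by linarith : 0 < ⟪u, v⟫), ← abs_mul, h6]
    refine (_root_.abs_sub _ _).trans ?_
    rw [abs_mul]
    have := mul_le_mul h3 h5 (abs_nonneg _) (by linarith [hC.pos])
    linarith
  calc |touchSlope ψ u v' - touchSlope ψ u v| ≤ 6 * C * ‖v' - v‖ := by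
        nlinarith [abs_nonneg (touchSlope ψ u v' - touchSlope ψ u v)]
    _ ≤ 6 * C * (4 * C / R * |t - s|) := by
        gcongr
        linarith [hC.pos]
    _ = _ := by ring

theorem hasDerivAt_of_norm_sub_le_sq {E : Type*} [NormedAddCommGroup E] [NormedSpace ℝ E]
    {g : ℝ → E} {g' : E} {s K : ℝ}
    (h : ∀ᶠ t in 𝓝 s, ‖g t - g s - (t - s) • g'‖ ≤ K * |t - s| ^ 2) : HasDerivAt g g' s := by
  have h1 : HasFDerivAt (fun t => g t - g s - (t - s) • g') (0 : ℝ →L[ℝ] E) s := by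
    refine Asymptotics.IsBigO.hasFDerivAt (n := 2) ?_ one_lt_two
    refine Asymptotics.IsBigO.of_bound K (h.mono fun t ht => ?_)
    simpa using ht
  have h2 : HasDerivAt (fun t : ℝ => (t - s) • g') g' s := by
    simpa using! ((hasDerivAt_id s).sub_const s).smul_const g'
  have h3 := (h1.hasDerivAt.add h2).add_const (g s)
  simpa using! h3

theorem eventually_abs_mul_lt {C R s : ℝ} (hs : |s| * (4 * C) < R) :
    ∀ᶠ t in 𝓝 s, |t| * (4 * C) < R :=
  (Continuous.tendsto (by fun_prop : Continuous fun t : ℝ => |t| * (4 * C)) s).eventually_lt_const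
    hs

section Family

variable {n : ℕ} {ψ : (𝔼 n) → ℝ} {C R : ℝ} {u : 𝔼 n} {ρ : ℝ → ℝ} {v : ℝ → 𝔼 n}

theorem hasDerivAt_radial (hψ : Differentiable ℝ ψ) (hC : HomGradBound ψ C) (hR : 0 < R)
    (hu : ‖u‖ = 1)
    (H : ∀ s, |s| * (4 * C) < R → IsTouching (fun w => R + s * ψ w) u (ρ s) (v s))
    {s : ℝ} (hs : |s| * (4 * C) < R) : HasDerivAt ρ (touchSlope ψ u (v s)) s := by
  refine hasDerivAt_of_norm_sub_le_sq (K := 6 * C * (4 * C / R))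
    ((eventually_abs_mul_lt hs).mono fun t ht => ?_)
  have h1 := (H s hs).sub_le (by linarith [(H s hs).half_le_inner hC hs hu]) (H t ht)
  have h2 := (H t ht).sub_le (by linarith [(H t ht).half_le_inner hC ht hu]) (H s hs)
  have h3 := (H s hs).abs_touchSlope_sub_le hψ hC hR hs ht hu (H t ht)
  have h4 : |(t - s) * (touchSlope ψ u (v t) - touchSlope ψ u (v s))|
      ≤ 6 * C * (4 * C / R) * |t - s| ^ 2 := by
    rw [abs_mul]
    calc _ ≤ |t - s| * (6 * C * (4 * C / R) * |t - s|) := by gcongr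
      _ = _ := by ring
  refine le_trans ?_ h4
  rw [Real.norm_eq_abs, smul_eq_mul, abs_of_nonpos (by linarith)]
  refine le_trans ?_ (neg_abs_le _ |> neg_le.1)
  linarith

theorem IsTouching.eq_of_const {v : 𝔼 n} {ρ : ℝ} (hψ : Differentiable ℝ ψ) (hR : 0 < R)
    (hu : ‖u‖ = 1)
    (H : IsTouching (fun w => R + 0 * ψ w) u ρ v) : ρ = R ∧ v = u := by
  have h1 := H.smul_eq hψ
  rw [zero_smul, add_zero] at h1
  have h2 : ρ = R := by
    have := congrArg norm h1
    simpa [norm_smul, hu, H.norm_eq, abs_of_pos hR, abs_of_pos H.pos] using this.symm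
  rw [h2] at h1
  exact ⟨h2, smul_right_injective _ hR.ne' h1⟩

theorem hasDerivAt_touchPoint (hψ : Differentiable ℝ ψ) (hC : HomGradBound ψ C)
    (hR : 0 < R) (hu : ‖u‖ = 1)
    (H : ∀ s, |s| * (4 * C) < R → IsTouching (fun w => R + s * ψ w) u (ρ s) (v s)) :
    HasDerivAt v (-(R⁻¹ • sphGrad ψ u)) 0 := by
  have h0 : |(0 : ℝ)| * (4 * C) < R := by simpa using hR
  obtain ⟨hρ0, hv0⟩ := (H 0 h0).eq_of_const hψ hR hu
  have hρ := hasDerivAt_radial hψ hC hR hu H h0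
  rw [hv0, touchSlope, real_inner_self_eq_norm_sq, hu, one_pow, div_one] at hρ
  have hw : HasDerivAt (fun s => s • homGrad ψ (v s)) (homGrad ψ u) 0 := by
    refine hasDerivAt_of_norm_sub_le_sq (K := C * (4 * C / R))
      ((eventually_abs_mul_lt h0).mono fun t ht => ?_)
    have h1 := (H 0 h0).norm_sub_le hψ hC hR h0 ht hu (H t ht)
    have h2 := hC.norm_sub_le (v t) u (H t ht).norm_eq hu
    rw [hv0] at h1
    rw [zero_smul, sub_zero, sub_zero, ← smul_sub, norm_smul, Real.norm_eq_abs]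
    rw [sub_zero] at h1
    calc |t| * ‖homGrad ψ (v t) - homGrad ψ u‖ ≤ |t| * (C * (4 * C / R * |t|)) := by
          gcongr
          exact h2.trans (mul_le_mul_of_nonneg_left h1 hC.pos.le)
      _ = _ := by ring
  have h1 := ((hρ.smul_const u).sub hw).const_smul R⁻¹
  have h2 : R⁻¹ • (ψ u • u - homGrad ψ u) = -(R⁻¹ • sphGrad ψ u) := by
    rw [homGrad]
    module
  rw [h2] at h1
  refine h1.congr_of_eventuallyEq ((eventually_abs_mul_lt h0).mono fun t ht => ?_)
  have h3 := (H t ht).smul_eq hψ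
  simp only [Pi.smul_apply, Pi.sub_apply]
  rw [← h3, add_sub_cancel_right, smul_smul, inv_mul_cancel₀ hR.ne', one_smul]

theorem hasDerivAt_touchSlope (hψ : Differentiable ℝ ψ) (hC : HomGradBound ψ C)
    (hR : 0 < R) (hu : ‖u‖ = 1)
    (H : ∀ s, |s| * (4 * C) < R → IsTouching (fun w => R + s * ψ w) u (ρ s) (v s)) :
    HasDerivAt (fun s => touchSlope ψ u (v s)) (-(‖sphGrad ψ u‖ ^ 2 / R)) 0 := by
  have h0 : |(0 : ℝ)| * (4 * C) < R := by simpa using hR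
  obtain ⟨hρ0, hv0⟩ := (H 0 h0).eq_of_const hψ hR hu
  have hv := hasDerivAt_touchPoint hψ hC hR hu H
  have hψ' : HasFDerivAt ψ (InnerProductSpace.toDual ℝ _ (gradient ψ u)) (v 0) := by
    rw [hv0]
    exact (hψ u).hasGradientAt.hasFDerivAt
  have h1 := hψ'.comp_hasDerivAt 0 hv
  have h2 : HasDerivAt (fun s => ⟪u, v s⟫) ⟪u, -(R⁻¹ • sphGrad ψ u)⟫ 0 :=
    (innerSL ℝ u).hasFDerivAt.comp_hasDerivAt 0 hv
  have hne : ⟪u, v 0⟫ ≠ 0 := by simp [hv0, hu]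
  have h3 := h1.div h2 hne
  have h4 : fderiv ℝ ψ u (sphGrad ψ u) = ‖sphGrad ψ u‖ ^ 2 := by
    rw [← inner_gradient_sphGrad ψ hu, gradient, InnerProductSpace.toDual_symm_apply]
  have h5 := inner_sphGrad_self ψ hu
  refine h3.congr_deriv ?_
  simp [hv0, hu, inner_neg_right, real_inner_smul_right, h4, h5]
  field_simp

end Family

theorem lintegral_eq_lintegral_toSphere {n : ℕ} (hn : 1 ≤ n) {F : (𝔼 n) → ℝ≥0∞}
    (hF : Measurable F) :
    ∫⁻ x, F x = ∫⁻ u : sphere (0 : 𝔼 n) 1,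
      (∫⁻ r in Ioi (0 : ℝ), ENNReal.ofReal (r ^ (n - 1)) * F (r • (u : 𝔼 n)))
        ∂(volume : Measure (𝔼 n)).toSphere := by
  have : Nontrivial (𝔼 n) := by
    have : Nonempty (Fin n) := ⟨⟨0, hn⟩⟩
    infer_instance
  have hmp := (volume : Measure (𝔼 n)).measurePreserving_homeomorphUnitSphereProd
  rw [finrank_euclideanSpace_fin] at hmp
  have hcont : Continuous fun p : sphere (0 : 𝔼 n) 1 × Ioi (0 : ℝ) =>
      (p.2 : ℝ) • (p.1 : 𝔼 n) := by fun_prop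
  have hFm : Measurable fun p : sphere (0 : 𝔼 n) 1 × Ioi (0 : ℝ) =>
      F ((p.2 : ℝ) • (p.1 : 𝔼 n)) := hF.comp hcont.measurable
  calc ∫⁻ x, F x = ∫⁻ x in ({0}ᶜ : Set (𝔼 n)), F x := by
        rw [restrict_compl_singleton]
    _ = ∫⁻ x : ({0}ᶜ : Set (𝔼 n)), F x ∂(volume.comap Subtype.val) :=
        (lintegral_subtype_comap (measurableSet_singleton _).compl F).symm
    _ = ∫⁻ x : ({0}ᶜ : Set (𝔼 n)), F (((homeomorphUnitSphereProd (𝔼 n) x).2 : ℝ) •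
          ((homeomorphUnitSphereProd (𝔼 n) x).1 : 𝔼 n)) ∂(volume.comap Subtype.val) := by
        refine lintegral_congr fun x => ?_
        have hx : ‖(x : 𝔼 n)‖ ≠ 0 := norm_ne_zero_iff.2 x.2
        congr 1
        simp [smul_smul, hx]
    _ = ∫⁻ p, F ((p.2 : ℝ) • (p.1 : 𝔼 n))
          ∂((volume : Measure (𝔼 n)).toSphere.prod (Measure.volumeIoiPow (n - 1))) :=
        hmp.lintegral_comp hFm
    _ = _ := by
        rw [lintegral_prod _ hFm.aemeasurable]
        refine lintegral_congr fun u => ?_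
        have h1 : Measurable fun r : Ioi (0 : ℝ) => ENNReal.ofReal ((r : ℝ) ^ (n - 1)) := by
          fun_prop
        have h2 : Measurable fun r : Ioi (0 : ℝ) => F ((r : ℝ) • (u : 𝔼 n)) :=
          hFm.comp measurable_prodMk_left
        rw [Measure.volumeIoiPow, lintegral_withDensity_eq_lintegral_mul _ h1 h2]
        exact lintegral_subtype_comap measurableSet_Ioi
          fun r : ℝ => ENNReal.ofReal (r ^ (n - 1)) * F (r • (u : 𝔼 n))

theorem withDensity_norm_apply_eq {n : ℕ} (hn : 1 ≤ n) {f : ℝ → ℝ}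
    (hf : ContinuousOn f (Ici 0)) (hf0 : ∀ t ∈ Ici (0 : ℝ), 0 ≤ f t) {K : Set (𝔼 n)}
    (hK : MeasurableSet K) {ρ : sphere (0 : 𝔼 n) 1 → ℝ} (hρ0 : ∀ u, 0 ≤ ρ u)
    (hρ : ∀ u : sphere (0 : 𝔼 n) 1, ∀ r : ℝ, 0 ≤ r → (r • (u : 𝔼 n) ∈ K ↔ r ≤ ρ u)) :
    (volume.withDensity fun x : 𝔼 n => ENNReal.ofReal (f ‖x‖)) K
      = ∫⁻ u, ENNReal.ofReal (∫ r in (0 : ℝ)..ρ u, r ^ (n - 1) * f r)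
          ∂(volume : Measure (𝔼 n)).toSphere := by
  have hfn : Continuous fun x : 𝔼 n => f ‖x‖ :=
    hf.comp_continuous continuous_norm fun x => norm_nonneg x
  have hFm : Measurable (K.indicator fun x : 𝔼 n => ENNReal.ofReal (f ‖x‖)) :=
    hfn.measurable.ennreal_ofReal.indicator hK
  rw [withDensity_apply _ hK, ← lintegral_indicator hK, lintegral_eq_lintegral_toSphere hn hFm]
  refine lintegral_congr fun u => ?_
  have hu : ‖(u : 𝔼 n)‖ = 1 := by simp
  have h1 : ∀ r ∈ Ioi (0 : ℝ), ENNReal.ofReal (r ^ (n - 1)) *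
      K.indicator (fun x : 𝔼 n => ENNReal.ofReal (f ‖x‖)) (r • (u : 𝔼 n))
      = (Iic (ρ u)).indicator (fun r => ENNReal.ofReal (r ^ (n - 1) * f r)) r := by
    intro r hr
    have hr0 : 0 ≤ r := le_of_lt hr
    by_cases h : r ≤ ρ u
    · rw [indicator_of_mem ((hρ u r hr0).2 h), indicator_of_mem (mem_Iic.2 h), norm_smul, hu,
        mul_one, Real.norm_of_nonneg hr0, ENNReal.ofReal_mul (pow_nonneg hr0 _)]
    · rw [indicator_of_notMem (fun h' => h ((hρ u r hr0).1 h')),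
        indicator_of_notMem (by simpa using h),
        mul_zero]
  have hcont : ContinuousOn (fun r : ℝ => r ^ (n - 1) * f r) (Icc 0 (ρ u)) :=
    (continuous_pow _).continuousOn.mul (hf.mono fun x hx => hx.1)
  rw [setLIntegral_congr_fun measurableSet_Ioi h1, setLIntegral_indicator measurableSet_Iic,
    inter_comm, Ioi_inter_Iic, intervalIntegral.integral_of_le (hρ0 u),
    ofReal_integral_eq_lintegral_ofReal]
  · exact (hcont.integrableOn_Icc).mono_set Ioc_subset_Icc_self
  · filter_upwards [ae_restrict_mem measurableSet_Ioc] with r hr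
    exact mul_nonneg (pow_nonneg hr.1.le _) (hf0 r hr.1.le)

theorem isClosed_bodyOf {n : ℕ} (h : (𝔼 n) → ℝ) : IsClosed (bodyOf h) := by
  have : bodyOf h = ⋂ u ∈ sphere (0 : 𝔼 n) 1, {x | ⟪x, u⟫ ≤ h u} := by
    ext x
    simp [bodyOf]
  rw [this]
  exact isClosed_biInter fun u _ => isClosed_le (by fun_prop) (by fun_prop)

theorem measurable_of_forall_smul_mem_iff {n : ℕ} {K : Set (𝔼 n)} (hK : MeasurableSet K)
    {ρ : sphere (0 : 𝔼 n) 1 → ℝ} (hρ0 : ∀ u, 0 ≤ ρ u)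
    (hρ : ∀ u : sphere (0 : 𝔼 n) 1, ∀ r : ℝ, 0 ≤ r → (r • (u : 𝔼 n) ∈ K ↔ r ≤ ρ u)) :
    Measurable ρ := by
  refine measurable_of_Ici fun r => ?_
  rcases le_total r 0 with hr | hr
  · convert MeasurableSet.univ
    ext u
    simpa using hr.trans (hρ0 u)
  · have : ρ ⁻¹' Ici r = (fun u : sphere (0 : 𝔼 n) 1 => r • (u : 𝔼 n)) ⁻¹' K := by
      ext u
      simp [hρ u r hr]
    rw [this]
    exact (by fun_prop : Continuous fun u : sphere (0 : 𝔼 n) 1 => r • (u : 𝔼 n)).measurable hK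

theorem deriv_and_deriv_deriv_integral_comp {α : Type*} [MeasurableSpace α] {μ : Measure α}
    [IsFiniteMeasure μ] {ρ D : ℝ → α → ℝ} {D' : α → ℝ} {δ K R φ' : ℝ} {Φ φ : ℝ → ℝ}
    {S : Set ℝ} (hδ : 0 < δ)
    (hρm : ∀ s ∈ ball (0 : ℝ) δ, Measurable (ρ s))
    (hρ : ∀ s ∈ ball (0 : ℝ) δ, ∀ u, HasDerivAt (ρ · u) (D s u) s)
    (hD : ∀ u, HasDerivAt (D · u) (D' u) 0) (hD'm : Measurable D')
    (hDb : ∀ s ∈ ball (0 : ℝ) δ, ∀ u, |D s u| ≤ K)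
    (hDl : ∀ s ∈ ball (0 : ℝ) δ, ∀ t ∈ ball (0 : ℝ) δ, ∀ u, |D s u - D t u| ≤ K * |s - t|)
    (hρS : ∀ s ∈ ball (0 : ℝ) δ, ∀ u, ρ s u ∈ S)
    (hρ0 : ∀ u, ρ 0 u = R) (hΦ : ∀ r, HasDerivAt Φ (φ r) r) (hφ : Continuous φ)
    (hφ' : HasDerivAt φ φ' R) (hΦb : ∀ r ∈ S, |Φ r| ≤ K) (hφb : ∀ r ∈ S, |φ r| ≤ K)
    (hφl : ∀ r ∈ S, ∀ r' ∈ S, |φ r - φ r'| ≤ K * |r - r'|) :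
    deriv (fun s => ∫ u, Φ (ρ s u) ∂μ) 0 = φ R * ∫ u, D 0 u ∂μ ∧
    deriv (deriv fun s => ∫ u, Φ (ρ s u) ∂μ) 0
      = φ' * (∫ u, D 0 u ^ 2 ∂μ) + φ R * ∫ u, D' u ∂μ := by
  have hΦc : Continuous Φ := continuous_iff_continuousAt.2 fun r => (hΦ r).continuousAt
  have hball : ∀ s ∈ ball (0 : ℝ) δ, ball (0 : ℝ) δ ∈ 𝓝 s := fun s hs =>
    isOpen_ball.mem_nhds hs
  have h0 : (0 : ℝ) ∈ ball (0 : ℝ) δ := mem_ball_self hδ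
  have hDm : ∀ s ∈ ball (0 : ℝ) δ, Measurable (D s) := by
    intro s hs
    have hlim : Tendsto (fun k : ℕ => s + (δ - |s|) / ((k : ℝ) + 2)) atTop (𝓝[≠] s) := by
      have hs' : 0 < δ - |s| := by simpa using hs
      refine tendsto_nhdsWithin_iff.2 ⟨?_, Eventually.of_forall fun k => ?_⟩
      · have : Tendsto (fun k : ℕ => (δ - |s|) / ((k : ℝ) + 2)) atTop (𝓝 0) :=
          tendsto_const_nhds.div_atTop
            (tendsto_atTop_add_const_right _ _ tendsto_natCast_atTop_atTop)
        simpa using this.const_add s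
      · have : 0 < (δ - |s|) / ((k : ℝ) + 2) := by positivity
        simp [this.ne']
    have hin : ∀ k : ℕ, s + (δ - |s|) / ((k : ℝ) + 2) ∈ ball (0 : ℝ) δ := by
      intro k
      have hs' : 0 < δ - |s| := by simpa using hs
      have h1 : (δ - |s|) / ((k : ℝ) + 2) < δ - |s| :=
        div_lt_self hs' (by linarith [(Nat.cast_nonneg k : (0 : ℝ) ≤ k)])
      have h2 : 0 < (δ - |s|) / ((k : ℝ) + 2) := by positivity
      rw [mem_ball_zero_iff, Real.norm_eq_abs]
      refine (abs_add_le _ _).trans_lt ?_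
      rw [abs_of_pos h2]
      linarith
    refine measurable_of_tendsto_metrizable
      (f := fun (k : ℕ) u => slope (ρ · u) s (s + (δ - |s|) / ((k : ℝ) + 2))) (fun k => ?_) ?_
    · simp only [slope_def_field]
      exact ((hρm _ (hin k)).sub (hρm s hs)).div_const _
    · rw [tendsto_pi_nhds]
      exact fun u => (hasDerivAt_iff_tendsto_slope.1 (hρ s hs u)).comp hlim
  have hρl : ∀ u, ∀ s ∈ ball (0 : ℝ) δ, ∀ t ∈ ball (0 : ℝ) δ,
      |ρ s u - ρ t u| ≤ K * |s - t| := by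
    intro u s hs t ht
    exact (convex_ball (0 : ℝ) δ).norm_image_sub_le_of_norm_hasDerivWithin_le
      (fun x hx => (hρ x hx u).hasDerivWithinAt) (fun x hx => hDb x hx u) ht hs
  have hder : ∀ s ∈ ball (0 : ℝ) δ,
      HasDerivAt (fun s => ∫ u, Φ (ρ s u) ∂μ) (∫ u, φ (ρ s u) * D s u ∂μ) s := by
    intro s hs
    refine (hasDerivAt_integral_of_dominated_loc_of_deriv_le (bound := fun _ => K * K)
      (F' := fun s u => φ (ρ s u) * D s u) (hball s hs) ?_ ?_ ?_ ?_ (integrable_const _) ?_).2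
    · filter_upwards [hball s hs] with t ht
      exact (hΦc.measurable.comp (hρm t ht)).aestronglyMeasurable
    · exact Integrable.of_bound (hΦc.measurable.comp (hρm s hs)).aestronglyMeasurable K
        (Eventually.of_forall fun u => hΦb _ (hρS s hs u))
    · exact ((hφ.measurable.comp (hρm s hs)).mul (hDm s hs)).aestronglyMeasurable
    · refine Eventually.of_forall fun u t ht => ?_
      rw [norm_mul]
      exact mul_le_mul (hφb _ (hρS t ht u)) (hDb t ht u) (abs_nonneg _)
        ((abs_nonneg _).trans (hφb _ (hρS t ht u)))
    · exact Eventually.of_forall fun u t ht => (hΦ _).comp t (hρ t ht u)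
  refine ⟨?_, ?_⟩
  · rw [(hder 0 h0).deriv]
    simp only [hρ0, integral_const_mul]
  have hev : (deriv fun s => ∫ u, Φ (ρ s u) ∂μ) =ᶠ[𝓝 0] fun s => ∫ u, φ (ρ s u) * D s u ∂μ := by
    filter_upwards [hball 0 h0] with s hs using (hder s hs).deriv
  rw [hev.deriv_eq]
  have hint : ∀ g : α → ℝ, Measurable g → (∀ u, |g u| ≤ K) → Integrable g μ := fun g hg hb =>
    Integrable.of_bound hg.aestronglyMeasurable K (Eventually.of_forall hb)
  have hD'b : ∀ u, |D' u| ≤ K := by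
    intro u
    have hK : 0 ≤ K := (abs_nonneg _).trans (hDb 0 h0 u)
    refine (hD u).le_of_lip' hK ?_
    filter_upwards [hball 0 h0] with s hs using hDl s hs 0 h0 u
  have h2 : HasDerivAt (fun s => ∫ u, φ (ρ s u) * D s u ∂μ)
      (∫ u, (φ' * D 0 u ^ 2 + φ R * D' u) ∂μ) 0 := by
    refine (hasDerivAt_integral_of_dominated_loc_of_lip
      (bound := fun _ => K * K * K + K * K) (hball 0 h0) ?_ ?_ ?_ ?_ (integrable_const _) ?_).2
    · filter_upwards [hball 0 h0] with t ht
      exact ((hφ.measurable.comp (hρm t ht)).mul (hDm t ht)).aestronglyMeasurable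
    · simp only [hρ0]
      exact (hint _ (hDm 0 h0) (hDb 0 h0)).const_mul _
    · exact ((((hDm 0 h0).pow_const 2).const_mul _).add
        (hD'm.const_mul _)).aestronglyMeasurable
    · refine Eventually.of_forall fun u => LipschitzOnWith.of_dist_le_mul fun s hs t ht => ?_
      have hK : 0 ≤ K := (abs_nonneg _).trans (hDb 0 h0 u)
      rw [Real.dist_eq, Real.dist_eq, Real.coe_nnabs,
        abs_of_nonneg (by positivity : 0 ≤ K * K * K + K * K)]
      have e : φ (ρ s u) * D s u - φ (ρ t u) * D t u
          = (φ (ρ s u) - φ (ρ t u)) * D s u + φ (ρ t u) * (D s u - D t u) := by ring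
      rw [e]
      refine (abs_add_le _ _).trans ?_
      rw [abs_mul, abs_mul, add_mul]
      have a1 : |φ (ρ s u) - φ (ρ t u)| ≤ K * (K * |s - t|) :=
        (hφl _ (hρS s hs u) _ (hρS t ht u)).trans
          (mul_le_mul_of_nonneg_left (hρl u s hs t ht) hK)
      have a2 := mul_le_mul a1 (hDb s hs u) (abs_nonneg _) (by positivity)
      have a3 := mul_le_mul (hφb _ (hρS t ht u)) (hDl s hs t ht u) (abs_nonneg _) hK
      linarith
    · refine Eventually.of_forall fun u => ?_
      have hφ0 : HasDerivAt φ φ' (ρ 0 u) := by rwa [hρ0]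
      refine ((hφ0.comp (0 : ℝ) (hρ 0 h0 u)).mul (hD u)).congr_deriv ?_
      simp only [Function.comp_apply, hρ0]
      ring
  rw [h2.deriv, integral_add, integral_const_mul, integral_const_mul]
  · refine Integrable.const_mul (Integrable.of_bound
      ((hDm 0 h0).pow_const 2).aestronglyMeasurable (K ^ 2) (Eventually.of_forall fun u => ?_)) _
    rw [norm_pow]
    exact pow_le_pow_left₀ (norm_nonneg _) (hDb 0 h0 u) 2
  · exact (hint _ hD'm hD'b).const_mul _

theorem toReal_withDensity_norm_bodyOf {n : ℕ} (hn : 1 ≤ n) {f : ℝ → ℝ} (hf : Continuous f)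
    (hf0 : ∀ t, 0 ≤ f t) {h : (𝔼 n) → ℝ} (hpos : ∀ w : 𝔼 n, ‖w‖ = 1 → 0 < h w)
    {ρ : sphere (0 : 𝔼 n) 1 → ℝ} {v : sphere (0 : 𝔼 n) 1 → 𝔼 n}
    (H : ∀ u : sphere (0 : 𝔼 n) 1, IsTouching h u (ρ u) (v u)) :
    Measurable ρ ∧ ((volume.withDensity fun x : 𝔼 n => ENNReal.ofReal (f ‖x‖)) (bodyOf h)).toReal
      = ∫ u, (∫ r in (0 : ℝ)..ρ u, r ^ (n - 1) * f r) ∂(volume : Measure (𝔼 n)).toSphere := by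
  have hK := (isClosed_bodyOf h).measurableSet
  have hρ0 : ∀ u, 0 ≤ ρ u := fun u => (H u).pos.le
  have hρ : ∀ u : sphere (0 : 𝔼 n) 1, ∀ r : ℝ, 0 ≤ r → (r • (u : 𝔼 n) ∈ bodyOf h ↔ r ≤ ρ u) :=
    fun u r hr => (H u).smul_mem_bodyOf_iff hpos hr
  have hm := measurable_of_forall_smul_mem_iff hK hρ0 hρ
  refine ⟨hm, ?_⟩
  rw [withDensity_norm_apply_eq hn hf.continuousOn (fun t _ => hf0 t) hK hρ0 hρ,
    integral_eq_lintegral_of_nonneg_ae]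
  · exact Eventually.of_forall fun u => intervalIntegral.integral_nonneg (hρ0 u) fun r hr =>
      mul_nonneg (pow_nonneg hr.1 _) (hf0 r)
  · have : Continuous fun x : ℝ => ∫ r in (0 : ℝ)..x, r ^ (n - 1) * f r :=
      intervalIntegral.continuous_primitive
        (fun a b => (by fun_prop : Continuous fun r => r ^ (n - 1) * f r).intervalIntegrable a b) 0
    exact (this.measurable.comp hm).aestronglyMeasurable

theorem derivs_toReal_withDensity_norm_bodyOf {n : ℕ} (hn : 1 ≤ n) {f : ℝ → ℝ}
    (hf : Continuous f) (hf0 : ∀ t, 0 ≤ f t) {R : ℝ} (hR : 0 < R) (hfR : ContDiffAt ℝ 1 f R)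
    {ψ : (𝔼 n) → ℝ} (hψ : ContDiff ℝ 2 ψ) {g : ℝ → ℝ}
    (hg : g = fun s => ((volume.withDensity fun x : 𝔼 n => ENNReal.ofReal (f ‖x‖))
      (bodyOf fun u => R + s * ψ u)).toReal) :
    g 0 = (volume : Measure (𝔼 n)).toSphere.real univ * ∫ r in (0 : ℝ)..R, r ^ (n - 1) * f r ∧
    deriv g 0 = R ^ (n - 1) * f R *
      ∫ u : sphere (0 : 𝔼 n) 1, ψ u ∂(volume : Measure (𝔼 n)).toSphere ∧
    deriv (deriv g) 0 = (((n - 1 : ℕ) : ℝ) * R ^ (n - 1 - 1) * f R + R ^ (n - 1) * deriv f R) *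
        (∫ u : sphere (0 : 𝔼 n) 1, ψ u ^ 2 ∂(volume : Measure (𝔼 n)).toSphere)
      - R ^ (n - 1) * f R / R *
        ∫ u : sphere (0 : 𝔼 n) 1, ‖sphGrad ψ u‖ ^ 2 ∂(volume : Measure (𝔼 n)).toSphere := by
  obtain ⟨C, hC⟩ := exists_homGradBound hψ
  have hψd : Differentiable ℝ ψ := hψ.differentiable two_ne_zero
  have hC0 := hC.pos
  have hex : ∀ s : ℝ, ∀ u : sphere (0 : 𝔼 n) 1, ∃ p : ℝ × 𝔼 n,
      |s| * (4 * C) < R → IsTouching (fun w => R + s * ψ w) u p.1 p.2 := by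
    intro s u
    by_cases hs : |s| * (4 * C) < R
    · obtain ⟨r, v, h⟩ := exists_isTouching (h := fun w => R + s * ψ w)
        (by have := hψ.continuous; fun_prop) (fun w hw => hC.add_mul_pos hs hw)
        (u := (u : 𝔼 n)) (by simp)
      exact ⟨(r, v), fun _ => h⟩
    · exact ⟨0, fun h => absurd h hs⟩
  choose p hp using hex
  have hu : ∀ u : sphere (0 : 𝔼 n) 1, ‖(u : 𝔼 n)‖ = 1 := fun u => by simp
  have hz : |(0 : ℝ)| * (4 * C) < R := by simpa using hR
  set φ : ℝ → ℝ := fun r => r ^ (n - 1) * f r with hφdef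
  have hφc : Continuous φ := by fun_prop
  set Φ : ℝ → ℝ := fun x => ∫ r in (0 : ℝ)..x, φ r with hΦdef
  have hΦ : ∀ r, HasDerivAt Φ (φ r) r := fun r => hφc.integral_hasStrictDerivAt 0 r |>.hasDerivAt
  have hφR : ContDiffAt ℝ 1 φ R := ((contDiff_id.pow (n - 1)).contDiffAt).mul hfR
  have hφ' : HasDerivAt φ
      (((n - 1 : ℕ) : ℝ) * R ^ (n - 1 - 1) * f R + R ^ (n - 1) * deriv f R) R :=
    (hasDerivAt_pow (n - 1) R).mul (hfR.differentiableAt one_ne_zero).hasDerivAt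
  obtain ⟨L, T, hT, hL⟩ := hφR.exists_lipschitzOnWith
  obtain ⟨η, hη, hηT⟩ := nhds_basis_closedBall.mem_iff.1 hT
  obtain ⟨a, ha⟩ := (isCompact_closedBall R η).exists_bound_of_continuousOn hφc.continuousOn
  obtain ⟨b, hb⟩ := (isCompact_closedBall R η).exists_bound_of_continuousOn
    (continuous_iff_continuousAt.2 fun r => (hΦ r).continuousAt).continuousOn
  set M : ℝ := max (max a b) (max (L : ℝ) (max (2 * C) (6 * C * (4 * C / R)))) with hM
  have hMa : a ≤ M := (le_max_left _ _).trans (le_max_left _ _)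
  have hMb : b ≤ M := (le_max_right _ _).trans (le_max_left _ _)
  have hML : L ≤ M := (le_max_left _ _).trans (le_max_right _ _)
  have hMC : 2 * C ≤ M := (le_max_left _ _).trans ((le_max_right _ _).trans (le_max_right _ _))
  have hMC' : 6 * C * (4 * C / R) ≤ M :=
    (le_max_right _ _).trans ((le_max_right _ _).trans (le_max_right _ _))
  set δ : ℝ := min (R / (4 * C)) (η / (2 * C)) with hδdef
  have hδ : 0 < δ := by positivity
  have hsmall : ∀ s ∈ ball (0 : ℝ) δ, |s| * (4 * C) < R := by
    intro s hs
    rw [← lt_div_iff₀ (by positivity)]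
    exact (show |s| < δ by simpa using hs).trans_le (min_le_left _ _)
  have hform : ∀ s, |s| * (4 * C) < R → Measurable (fun u => (p s u).1) ∧
      g s = ∫ u, Φ (p s u).1 ∂(volume : Measure (𝔼 n)).toSphere := by
    intro s hs
    rw [hg]
    exact toReal_withDensity_norm_bodyOf hn hf hf0 (fun w hw => hC.add_mul_pos hs hw)
      fun u => hp s u hs
  have hp0 : ∀ u, (p 0 u).1 = R ∧ (p 0 u).2 = u := fun u =>
    (hp 0 u hz).eq_of_const hψd hR (hu u)
  have hD0 : ∀ u : sphere (0 : 𝔼 n) 1, touchSlope ψ u (p 0 u).2 = ψ u := fun u => by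
    rw [(hp0 u).2, touchSlope, real_inner_self_eq_norm_sq, hu u, one_pow, div_one]
  have key := deriv_and_deriv_deriv_integral_comp (μ := (volume : Measure (𝔼 n)).toSphere)
    (ρ := fun s u => (p s u).1) (D := fun s u => touchSlope ψ u (p s u).2)
    (D' := fun u => -(‖sphGrad ψ u‖ ^ 2 / R)) (K := M) (R := R) (Φ := Φ) (φ := φ)
    (S := closedBall R η) hδ
    (fun s hs => (hform s (hsmall s hs)).1)
    (fun s hs u => hasDerivAt_radial (v := fun s => (p s u).2) hψd hC hR (hu u)
      (fun t ht => hp t u ht) (hsmall s hs))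
    (fun u => hasDerivAt_touchSlope (ρ := fun s => (p s u).1) hψd hC hR (hu u)
      (fun t ht => hp t u ht))
    (by
      have := (contDiff_sphGrad hψ).continuous
      exact (by fun_prop : Continuous fun u : sphere (0 : 𝔼 n) 1 =>
        -(‖sphGrad ψ u‖ ^ 2 / R)).measurable)
    (fun s hs u => ((hp s u (hsmall s hs)).abs_touchSlope_le hC (hsmall s hs) (hu u)).trans hMC)
    (fun s hs t ht u => ((hp t u (hsmall t ht)).abs_touchSlope_sub_le hψd hC hR (hsmall t ht)
      (hsmall s hs) (hu u) (hp s u (hsmall s hs))).trans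
        (mul_le_mul_of_nonneg_right hMC' (abs_nonneg _)))
    (fun s hs u => by
      have h1 := (hp 0 u hz).abs_sub_le hC hz (hsmall s hs) (hu u) (hp s u (hsmall s hs))
      rw [(hp0 u).1, sub_zero] at h1
      rw [mem_closedBall, Real.dist_eq]
      refine h1.trans ?_
      rw [← le_div_iff₀' (by positivity)]
      exact (show |s| < δ by simpa using hs).le.trans (min_le_right _ _))
    (fun u => (hp0 u).1) hΦ hφc hφ'
    (fun r hr => (hb r hr).trans hMb) (fun r hr => (ha r hr).trans hMa)
    (fun r hr r' hr' => by
      have := hL.dist_le_mul r (hηT hr) r' (hηT hr')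
      rw [Real.dist_eq, Real.dist_eq] at this
      exact this.trans (mul_le_mul_of_nonneg_right hML (abs_nonneg _)))
  have hev : g =ᶠ[𝓝 0] fun s => ∫ u, Φ (p s u).1 ∂(volume : Measure (𝔼 n)).toSphere :=
    (eventually_abs_mul_lt hz).mono fun s hs => (hform s hs).2
  refine ⟨?_, ?_, ?_⟩
  · rw [(hform 0 hz).2]
    simp only [hp0, integral_const, smul_eq_mul, hΦdef]
  · rw [hev.deriv_eq, key.1]
    simp only [hD0, hφdef]
  · rw [hev.deriv.deriv_eq, key.2]
    simp only [hD0, hφdef, integral_neg, integral_div]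
    ring

theorem integral_pow_mul_eq_pow_mul {n : ℕ} (hn : 1 ≤ n) (f : ℝ → ℝ) (R : ℝ) :
    ∫ r in (0 : ℝ)..R, r ^ (n - 1) * f r
      = R ^ n * ∫ t in (0 : ℝ)..1, t ^ (n - 1) * f (R * t) := by
  have h := intervalIntegral.mul_integral_comp_mul_left (a := 0) (b := 1)
    (f := fun r => r ^ (n - 1) * f r) (c := R)
  rw [mul_zero, mul_one] at h
  rw [← h, ← Nat.sub_add_cancel hn, pow_succ', mul_assoc, Nat.add_sub_cancel,
    ← intervalIntegral.integral_const_mul (R ^ (n - 1))]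
  congr 2
  ext t
  ring

end RadialFunction

/-- **Lemma 4 (Lemma L-T-1).** For a rotation invariant measure `γ` with density `f(|x|)`
and `h_K = R`, the infinitesimal dimensional Brunn-Minkowski condition
`g''(0)·g(0) ≤ ((n-1)/n)·g'(0)²` (for every `ψ ∈ C²(𝕊ⁿ⁻¹)`) is equivalent to the
integral inequality (ii). -/
theorem dim_BM_second_derivative_condition_iff (n : ℕ) (hn : 2 ≤ n)
    (γ : Measure (EuclideanSpace ℝ (Fin n)))
    (f : ℝ → ℝ) (hf : ContDiffOn ℝ 2 f (Ici 0)) (hfpos : ∀ t ∈ Ici (0:ℝ), 0 ≤ f t)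
    (hγ : γ = volume.withDensity (fun x => ENNReal.ofReal (f ‖x‖)))
    (R : ℝ) (hR : 0 < R)
    (A : ℝ) (hA : A = ∫ t in (0:ℝ)..1, t ^ (n - 1) * f (R * t)) :
    -- (i) the second-order condition along every family K(R, ψ, I)
    (∀ ψ : EuclideanSpace ℝ (Fin n) → ℝ, ContDiff ℝ 2 ψ →
        deriv (deriv (fun s : ℝ => (γ (bodyOf (fun u => R + s * ψ u))).toReal)) 0
            * (γ (bodyOf (fun _ => R))).toReal
          ≤ ((n:ℝ) - 1) / n
            * (deriv (fun s : ℝ => (γ (bodyOf (fun u => R + s * ψ u))).toReal) 0) ^ 2)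
    ↔
    -- (ii) the integral inequality on the sphere
    (∀ ψ : EuclideanSpace ℝ (Fin n) → ℝ, ContDiff ℝ 2 ψ →
        A * f R / (((volume : Measure (EuclideanSpace ℝ (Fin n))).toSphere univ).toReal)
            * (((n:ℝ) - 1)
                * (∫ u : sphere (0 : EuclideanSpace ℝ (Fin n)) 1, (ψ ↑u) ^ 2
                    ∂((volume : Measure (EuclideanSpace ℝ (Fin n))).toSphere))
              - ∫ u : sphere (0 : EuclideanSpace ℝ (Fin n)) 1, ‖sphGrad ψ ↑u‖ ^ 2
                    ∂((volume : Measure (EuclideanSpace ℝ (Fin n))).toSphere))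
          + A * R * deriv f R
              / (((volume : Measure (EuclideanSpace ℝ (Fin n))).toSphere univ).toReal)
            * (∫ u : sphere (0 : EuclideanSpace ℝ (Fin n)) 1, (ψ ↑u) ^ 2
                ∂((volume : Measure (EuclideanSpace ℝ (Fin n))).toSphere))
        ≤ ((n:ℝ) - 1) / n * (f R) ^ 2
            * ((1 / (((volume : Measure (EuclideanSpace ℝ (Fin n))).toSphere univ).toReal))
                * ∫ u : sphere (0 : EuclideanSpace ℝ (Fin n)) 1, ψ ↑u
                    ∂((volume : Measure (EuclideanSpace ℝ (Fin n))).toSphere)) ^ 2) := by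
  set F : ℝ → ℝ := fun t => f (max t 0) with hF
  have hFc : Continuous F :=
    hf.continuousOn.comp_continuous (by fun_prop) fun t => mem_Ici.2 (le_max_right _ _)
  have hF0 : ∀ t, 0 ≤ F t := fun t => hfpos _ (mem_Ici.2 (le_max_right _ _))
  have hFf : ∀ t, 0 ≤ t → F t = f t := fun t ht => by simp [hF, ht]
  have hFev : F =ᶠ[nhds R] f := by
    filter_upwards [lt_mem_nhds hR] with t ht using hFf t ht.le
  have hfR : ContDiffAt ℝ 1 F R :=
    ((hf.contDiffAt (Ici_mem_nhds hR)).of_le one_le_two).congr_of_eventuallyEq hFev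
  have hγF : γ = volume.withDensity fun x : EuclideanSpace ℝ (Fin n) => ENNReal.ofReal (F ‖x‖) := by
    rw [hγ]
    congr 1
    ext x
    rw [hFf _ (norm_nonneg x)]
  have hn1 : 1 ≤ n := by omega
  have hAF : ∫ r in (0 : ℝ)..R, r ^ (n - 1) * F r = R ^ n * A := by
    rw [hA, ← integral_pow_mul_eq_pow_mul hn1]
    refine intervalIntegral.integral_congr fun r hr => ?_
    rw [uIcc_of_le hR.le] at hr
    simp only [hFf r hr.1]
  have hω : 0 < ((volume : Measure (EuclideanSpace ℝ (Fin n))).toSphere univ).toReal := by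
    refine ENNReal.toReal_pos ?_ (measure_ne_top _ _)
    simp only [Measure.toSphere_apply_univ, finrank_euclideanSpace, Fintype.card_fin]
    exact mul_ne_zero (by exact_mod_cast (show n ≠ 0 by omega))
      (Metric.measure_ball_pos _ _ one_pos).ne'
  refine forall₂_congr fun ψ hψ => ?_
  obtain ⟨h0, h1, h2⟩ := derivs_toReal_withDensity_norm_bodyOf hn1 hFc hF0 hR hfR hψ rfl
  rw [← hγF] at h0 h1 h2
  simp only [zero_mul, add_zero] at h0
  rw [h0, h1, h2, hAF, hFev.deriv_eq, hFf R hR.le, measureReal_def]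
  obtain ⟨m, rfl⟩ := Nat.exists_eq_add_of_le hn
  set ω := ((volume : Measure (EuclideanSpace ℝ (Fin (2 + m)))).toSphere univ).toReal
  set I₂ := ∫ u : sphere (0 : EuclideanSpace ℝ (Fin (2 + m))) 1, (ψ ↑u) ^ 2
    ∂((volume : Measure (EuclideanSpace ℝ (Fin (2 + m)))).toSphere)
  set I₁ := ∫ u : sphere (0 : EuclideanSpace ℝ (Fin (2 + m))) 1, ψ ↑u
    ∂((volume : Measure (EuclideanSpace ℝ (Fin (2 + m)))).toSphere)
  set J := ∫ u : sphere (0 : EuclideanSpace ℝ (Fin (2 + m))) 1, ‖sphGrad ψ ↑u‖ ^ 2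
    ∂((volume : Measure (EuclideanSpace ℝ (Fin (2 + m)))).toSphere)
  have e1 : 2 + m - 1 = m + 1 := by omega
  have e2 : m + 1 - 1 = m := by omega
  have hscale : 0 < ω ^ 2 * (R ^ (m + 1)) ^ 2 := by positivity
  rw [← mul_le_mul_iff_right₀ hscale (b := _ + _)]
  refine iff_of_eq (congrArg₂ _ ?_ ?_)
  · rw [e1, e2]
    push_cast
    field_simp
    ring
  · rw [e1]
    field_simp
end
end

section
/- Let n ≥ 2, let f : [0,∞) → [0,∞) be a C² function such that x ↦ f(|x|) is a log-concave density on ℝⁿ (in particular f is non-increasing), let R > 0 and set A = ∫₀¹ t^{n−1} f(Rt) dt. Then for every ψ ∈ C²(𝕊ⁿ⁻¹): (A f(R)/|𝕊ⁿ⁻¹|)·((n−1)∫_{𝕊ⁿ⁻¹} ψ² du − ∫_{𝕊ⁿ⁻¹} |∇_σψ|² du) + (A R f'(R)/|𝕊ⁿ⁻¹|)·∫_{𝕊ⁿ⁻¹} ψ² du ≤ ((n−1)/n) f(R)² · ((1/|𝕊ⁿ⁻¹|)∫_{𝕊ⁿ⁻¹} ψ du)². -/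
open MeasureTheory Metric Set Pointwise
open scoped ENNReal RealInnerProductSpace

noncomputable section

lemma fourierCoeffOn_two_pi_eq (f : ℝ → ℂ) (n : ℤ) :
    fourierCoeffOn Real.two_pi_pos f n
      = (1 / (2 * Real.pi)) •
        ∫ x in (0:ℝ)..2 * Real.pi, Complex.exp (-(Complex.I * n * x)) * f x := by
  rw [fourierCoeffOn_eq_integral, sub_zero]
  congr 1
  refine intervalIntegral.integral_congr fun x _ => ?_
  simp only [fourier_coe_apply, smul_eq_mul]
  congr 2
  have : (Real.pi : ℂ) ≠ 0 := by exact_mod_cast Real.pi_ne_zero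
  push_cast
  field_simp

lemma fourierCoeffOn_shift {h : ℝ → ℂ} (hc : Continuous h)
    (hp : Function.Periodic h (2 * Real.pi)) (a : ℝ) (n : ℤ) :
    fourierCoeffOn Real.two_pi_pos (fun x => h (x + a) - h x) n
      = (Complex.exp (Complex.I * n * a) - 1) * fourierCoeffOn Real.two_pi_pos h n := by
  simp only [fourierCoeffOn_two_pi_eq]
  have hper : Function.Periodic (fun x : ℝ => Complex.exp (-(Complex.I * n * x)) * h x)
      (2 * Real.pi) := by
    intro x
    simp only [hp x]
    congr 1
    rw [Complex.exp_eq_exp_iff_exists_int]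
    exact ⟨-n, by push_cast; ring⟩
  have key : ∫ x in (0:ℝ)..2 * Real.pi, Complex.exp (-(Complex.I * n * x)) * h (x + a)
      = Complex.exp (Complex.I * n * a)
        * ∫ x in (0:ℝ)..2 * Real.pi, Complex.exp (-(Complex.I * n * x)) * h x := by
    have h1 := hper.intervalIntegral_add_eq a 0
    rw [zero_add] at h1
    rw [← h1, ← intervalIntegral.integral_const_mul]
    have h2 := intervalIntegral.integral_comp_add_right (a := 0) (b := 2 * Real.pi)
      (fun x : ℝ => Complex.exp (Complex.I * n * a) *
        (Complex.exp (-(Complex.I * n * x)) * h x)) a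
    rw [zero_add, add_comm (2 * Real.pi)] at h2
    rw [← h2]
    refine intervalIntegral.integral_congr fun x _ => ?_
    simp only [← mul_assoc, ← Complex.exp_add]
    congr 2
    push_cast
    ring
  simp only [mul_sub]
  rw [intervalIntegral.integral_sub, key]
  · simp only [Complex.real_smul]
    ring
  · exact Continuous.intervalIntegrable (by fun_prop) _ _
  · exact Continuous.intervalIntegrable (by fun_prop) _ _

lemma fourierCoeffOn_deriv {h h' : ℝ → ℂ} (hd : ∀ x, HasDerivAt h (h' x) x)
    (hc : Continuous h') (hp : Function.Periodic h (2 * Real.pi)) (n : ℤ) :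
    fourierCoeffOn Real.two_pi_pos h' n
      = Complex.I * n * fourierCoeffOn Real.two_pi_pos h n := by
  have hpi : (Real.pi : ℂ) ≠ 0 := by exact_mod_cast Real.pi_ne_zero
  have hend : h (2 * Real.pi) = h 0 := by simpa using hp 0
  rcases eq_or_ne n 0 with rfl | hn
  · rw [fourierCoeffOn_two_pi_eq]
    have := intervalIntegral.integral_eq_sub_of_hasDerivAt (a := 0) (b := 2 * Real.pi)
      (fun x _ => hd x) (hc.intervalIntegrable _ _)
    simp [this, hend]
  · rw [fourierCoeffOn_of_hasDerivAt Real.two_pi_pos hn (fun x _ => hd x)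
      (hc.intervalIntegrable _ _), hend]
    have hn' : (n : ℂ) ≠ 0 := by exact_mod_cast hn
    push_cast
    field_simp
    ring

lemma norm_exp_quarter_sub_one_sq_le (n : ℤ) :
    ‖Complex.exp (Complex.I * n * (Real.pi / 2 : ℝ)) - 1‖ ^ 2 ≤ 2 * (n : ℝ) ^ 2 := by
  have e : Complex.I * n * (Real.pi / 2 : ℝ) = Complex.I * ((n * (Real.pi / 2) : ℝ) : ℂ) := by
    push_cast; ring
  rw [e, Complex.norm_exp_I_mul_ofReal_sub_one, Real.norm_eq_abs, sq_abs]
  rcases eq_or_ne n 0 with rfl | h0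
  · simp
  have hs : Real.sin (Real.pi / 4) ^ 2 = 1 / 2 := by
    rw [Real.sin_pi_div_four, div_pow, Real.sq_sqrt (by norm_num)]; norm_num
  rcases eq_or_ne n 1 with rfl | h1
  · rw [show ((1 : ℤ) * (Real.pi / 2) / 2 : ℝ) = Real.pi / 4 by push_cast; ring, mul_pow, hs]
    norm_num
  rcases eq_or_ne n (-1) with rfl | h2
  · rw [show (((-1 : ℤ) : ℝ) * (Real.pi / 2) / 2 : ℝ) = -(Real.pi / 4) by push_cast; ring,
      Real.sin_neg, mul_pow, neg_sq, hs]
    norm_num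
  have h4 : (4 : ℝ) ≤ (n : ℝ) ^ 2 := by
    have : 4 ≤ n ^ 2 := by
      rcases lt_or_gt_of_ne h0 with h | h
      · nlinarith [show n ≤ -2 by lia]
      · nlinarith [show 2 ≤ n by lia]
    exact_mod_cast this
  nlinarith [Real.sin_sq_le_one (n * (Real.pi / 2) / 2)]

lemma integral_sq_quarter_shift_le {h h' : ℝ → ℝ} (hd : ∀ x, HasDerivAt h (h' x) x)
    (hc : Continuous h') (hp : Function.Periodic h (2 * Real.pi)) :
    ∫ x in (0:ℝ)..2 * Real.pi, (h (x + Real.pi / 2) - h x) ^ 2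
      ≤ 2 * ∫ x in (0:ℝ)..2 * Real.pi, h' x ^ 2 := by
  have hcont : Continuous h := continuous_iff_continuousAt.2 fun x => (hd x).continuousAt
  have mem : ∀ g : ℝ → ℂ, Continuous g →
      MemLp g 2 (volume.restrict (Ioc 0 (2 * Real.pi))) := fun g hg =>
    by
    obtain ⟨C, hC⟩ := isCompact_Icc.exists_bound_of_continuousOn
      (hg.continuousOn (s := Icc 0 (2 * Real.pi)))
    exact MemLp.of_bound hg.aestronglyMeasurable C
      ((ae_restrict_iff' measurableSet_Ioc).2 (.of_forall fun x hx => hC x (Ioc_subset_Icc_self hx)))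
  have P1 := hasSum_sq_fourierCoeffOn Real.two_pi_pos
    (mem (fun x => ((h (x + Real.pi / 2) : ℝ) : ℂ) - (h x : ℝ)) (by fun_prop))
  have P2 := hasSum_sq_fourierCoeffOn Real.two_pi_pos
    (mem (fun x => ((h' x : ℝ) : ℂ)) (by fun_prop))
  have hp' : Function.Periodic (fun x => (h x : ℂ)) (2 * Real.pi) := fun x => by simp [hp x]
  have hle := hasSum_le (fun n => ?_) P1 (P2.mul_left 2)
  · have e1 : ∀ x, ‖((h (x + Real.pi / 2) : ℝ) : ℂ) - (h x : ℝ)‖ ^ 2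
        = (h (x + Real.pi / 2) - h x) ^ 2 := fun x => by
      rw [← Complex.ofReal_sub, Complex.norm_real, Real.norm_eq_abs, sq_abs]
    simp only [e1, Complex.norm_real, Real.norm_eq_abs, sq_abs, smul_eq_mul, sub_zero] at hle
    have : (0:ℝ) < (2 * Real.pi)⁻¹ := by positivity
    nlinarith
  · rw [fourierCoeffOn_shift (h := fun x => (h x : ℂ)) (by fun_prop) hp',
      fourierCoeffOn_deriv (fun x => (hd x).ofReal_comp) (by fun_prop) hp', norm_mul, norm_mul,
      mul_pow, mul_pow, ← mul_assoc]
    gcongr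
    simpa using norm_exp_quarter_sub_one_sq_le n

/-- The measure on `E` with density `exp (-‖x‖²)` with respect to the volume. -/
def gaussianVolume (E : Type*) [NormedAddCommGroup E] [InnerProductSpace ℝ E]
    [FiniteDimensional ℝ E] [MeasurableSpace E] [BorelSpace E] : Measure E :=
  volume.withDensity fun x => ENNReal.ofReal (Real.exp (-‖x‖ ^ 2))

section GaussianVolume

variable {E : Type*} [NormedAddCommGroup E] [InnerProductSpace ℝ E]
    [FiniteDimensional ℝ E] [MeasurableSpace E] [BorelSpace E]

lemma integral_gaussianVolume (f : E → ℝ) :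
    ∫ x, f x ∂gaussianVolume E = ∫ x, Real.exp (-‖x‖ ^ 2) * f x := by
  rw [gaussianVolume, integral_withDensity_eq_integral_toReal_smul (by fun_prop) (by simp)]
  simp [ENNReal.toReal_ofReal, Real.exp_nonneg]

lemma integrable_gaussianVolume_norm_pow [Nontrivial E] (k : ℕ) :
    Integrable (fun x => ‖x‖ ^ k) (gaussianVolume E) := by
  rw [gaussianVolume, integrable_withDensity_iff_integrable_smul' (by fun_prop) (by simp)]
  simp only [ENNReal.toReal_ofReal, Real.exp_nonneg, smul_eq_mul]
  rw [integrable_fun_norm_addHaar volume (f := fun r => Real.exp (-r ^ 2) * r ^ k)]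
  have := integrableOn_rpow_mul_exp_neg_mul_sq one_pos
    (s := ((Module.finrank ℝ E - 1 + k : ℕ) : ℝ)) (by
      have : (0 : ℝ) ≤ ((Module.finrank ℝ E - 1 + k : ℕ) : ℝ) := Nat.cast_nonneg _
      linarith)
  refine this.congr_fun (fun r _ => ?_) measurableSet_Ioi
  simp only [Real.rpow_natCast, pow_add, smul_eq_mul]
  ring_nf

instance [Nontrivial E] : IsFiniteMeasure (gaussianVolume E) := by
  have := integrable_gaussianVolume_norm_pow (E := E) 0
  simp only [pow_zero] at this
  exact (integrable_const_iff_isFiniteMeasure one_ne_zero).1 this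

lemma gaussianVolume_singleton [Nontrivial E] (a : E) : gaussianVolume E {a} = 0 :=
  withDensity_absolutelyContinuous _ _ (measure_singleton a)

/-- The radial factor of the Gaussian integral of a `k`-homogeneous function. -/
def gaussianRadialMoment (E : Type*) [NormedAddCommGroup E] [InnerProductSpace ℝ E] (k : ℕ) : ℝ :=
  ∫ r : Ioi (0 : ℝ), r.1 ^ k * Real.exp (-r.1 ^ 2)
    ∂Measure.volumeIoiPow (Module.finrank ℝ E - 1)

lemma integral_gaussianVolume_homogeneous [Nontrivial E] (k : ℕ) (g : E → ℝ) :
    ∫ x, ‖x‖ ^ k * g (‖x‖⁻¹ • x) ∂gaussianVolume E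
      = gaussianRadialMoment E k
        * ∫ u : sphere (0 : E) 1, g u ∂(volume : Measure E).toSphere := by
  have hpolar := (volume : Measure E).measurePreserving_homeomorphUnitSphereProd.integral_comp
    (homeomorphUnitSphereProd E).measurableEmbedding
    (fun p : sphere (0 : E) 1 × Ioi (0 : ℝ) => g p.1 * (p.2.1 ^ k * Real.exp (-p.2.1 ^ 2)))
  have hcomap := integral_subtype_comap (μ := (volume : Measure E))
    (measurableSet_singleton (0 : E)).compl
    (fun x : E => Real.exp (-‖x‖ ^ 2) * (‖x‖ ^ k * g (‖x‖⁻¹ • x)))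
  rw [restrict_compl_singleton] at hcomap
  rw [integral_gaussianVolume, mul_comm, gaussianRadialMoment,
    ← integral_prod_mul (fun u : sphere (0 : E) 1 => g u)
      (fun r : Ioi (0 : ℝ) => r.1 ^ k * Real.exp (-r.1 ^ 2)), ← hpolar, ← hcomap]
  refine integral_congr_ae (.of_forall fun x => ?_)
  simp only [homeomorphUnitSphereProd_apply_snd_coe, homeomorphUnitSphereProd_apply_fst_coe]
  ring

lemma gaussianRadialMoment_pos [Nontrivial E] (k : ℕ) : 0 < gaussianRadialMoment E k := by
  have h := integral_gaussianVolume_homogeneous (E := E) k (fun _ => 1)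
  simp only [mul_one] at h
  have hpos : 0 < ∫ x : E, ‖x‖ ^ k ∂gaussianVolume E := by
    rw [integral_pos_iff_support_of_nonneg (fun x => by positivity)
      (integrable_gaussianVolume_norm_pow k)]
    refine pos_of_ne_zero fun h0 => ?_
    have hsub : ({0}ᶜ : Set E) ⊆ Function.support fun x : E => ‖x‖ ^ k := fun x hx =>
      pow_ne_zero _ (norm_ne_zero_iff.2 hx)
    have hac : (volume : Measure E) ≪ gaussianVolume E :=
      withDensity_absolutelyContinuous' (by fun_prop)
        (.of_forall fun x => by simp [Real.exp_pos])
    exact (isOpen_compl_singleton.measure_pos volume (exists_ne (0 : E))).ne'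
      (hac (measure_mono_null hsub h0))
  have h0 : 0 ≤ gaussianRadialMoment E k :=
    integral_nonneg fun r => mul_nonneg (pow_nonneg r.2.le _) (Real.exp_nonneg _)
  rcases h0.eq_or_lt with h0 | h0
  · rw [h, ← h0, zero_mul] at hpos
    exact absurd hpos (lt_irrefl _)
  · exact h0

lemma measurePreserving_gaussianVolume (e : E ≃ₗᵢ[ℝ] E) :
    MeasurePreserving e (gaussianVolume E) (gaussianVolume E) := by
  refine ⟨e.continuous.measurable, ?_⟩
  ext s hs
  have h := e.measurePreserving.setLIntegral_comp_preimage hs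
    (f := fun x => ENNReal.ofReal (Real.exp (-‖x‖ ^ 2))) (by fun_prop)
  simp only [LinearIsometryEquiv.norm_map] at h
  rw [Measure.map_apply e.continuous.measurable hs, gaussianVolume,
    withDensity_apply _ hs, withDensity_apply _ (e.continuous.measurable hs), h]

lemma integral_gaussianVolume_inner_sq_eq_of_norm_eq {v w : E} (h : ‖v‖ = ‖w‖) :
    ∫ y, ⟪v, y⟫ ^ 2 ∂gaussianVolume E = ∫ y, ⟪w, y⟫ ^ 2 ∂gaussianVolume E := by
  obtain ⟨e, he⟩ : ∃ e : E ≃ₗᵢ[ℝ] E, e v = w := ⟨_, Submodule.reflection_sub h⟩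
  rw [← (measurePreserving_gaussianVolume e).integral_comp e.toHomeomorph.measurableEmbedding
    fun y => ⟪w, y⟫ ^ 2]
  simp only [← he, LinearIsometryEquiv.inner_map_map]

lemma integrable_gaussianVolume_inner_sq [Nontrivial E] (v : E) :
    Integrable (fun y => ⟪v, y⟫ ^ 2) (gaussianVolume E) := by
  refine ((integrable_gaussianVolume_norm_pow 2).const_mul (‖v‖ ^ 2)).mono'
    (by fun_prop) (.of_forall fun y => ?_)
  rw [Real.norm_eq_abs, abs_pow, ← mul_pow]
  gcongr
  exact abs_real_inner_le_norm v y

lemma integral_gaussianVolume_inner_sq [Nontrivial E] (v : E) :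
    Module.finrank ℝ E * ∫ y, ⟪v, y⟫ ^ 2 ∂gaussianVolume E
      = ‖v‖ ^ 2 * ∫ y, ‖y‖ ^ 2 ∂gaussianVolume E := by
  let b := stdOrthonormalBasis ℝ E
  have h1 : ∀ i, ∫ y, ⟪v, y⟫ ^ 2 ∂gaussianVolume E
      = ‖v‖ ^ 2 * ∫ y, ⟪b i, y⟫ ^ 2 ∂gaussianVolume E := fun i => by
    rw [integral_gaussianVolume_inner_sq_eq_of_norm_eq (w := ‖v‖ • b i) (by simp [norm_smul]),
      ← integral_const_mul]
    simp_rw [real_inner_smul_left, mul_pow]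
  have h2 := Finset.sum_congr (s₁ := Finset.univ) rfl fun i _ => h1 i
  rw [Finset.sum_const, Finset.card_univ, Fintype.card_fin, nsmul_eq_mul, ← Finset.mul_sum,
    ← integral_finsetSum _ fun i _ => integrable_gaussianVolume_inner_sq _] at h2
  simpa only [b.sum_sq_inner_right] using h2

end GaussianVolume

section Poincare

variable {E : Type*} [NormedAddCommGroup E] [InnerProductSpace ℝ E]

/-- The rotation of angle `θ` acting on pairs of vectors. -/
def pairRotation (θ : ℝ) (p : E × E) : E × E :=
  (Real.cos θ • p.1 + Real.sin θ • p.2, -Real.sin θ • p.1 + Real.cos θ • p.2)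

lemma continuous_pairRotation : Continuous fun q : ℝ × (E × E) => pairRotation q.1 q.2 := by
  unfold pairRotation
  fun_prop

lemma norm_sq_pairRotation (θ : ℝ) (p : E × E) :
    ‖(pairRotation θ p).1‖ ^ 2 + ‖(pairRotation θ p).2‖ ^ 2 = ‖p.1‖ ^ 2 + ‖p.2‖ ^ 2 := by
  simp only [pairRotation, norm_add_sq_real, norm_smul, mul_pow, real_inner_smul_left,
    real_inner_smul_right, Real.norm_eq_abs, sq_abs, neg_sq]
  linear_combination (‖p.1‖ ^ 2 + ‖p.2‖ ^ 2) * Real.sin_sq_add_cos_sq θ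

variable [FiniteDimensional ℝ E] [MeasurableSpace E] [BorelSpace E]

lemma measurePreserving_pairRotation_volume (θ : ℝ) :
    MeasurePreserving (pairRotation θ : E × E → E × E) volume volume := by
  let L : WithLp 2 (E × E) →ₗ[ℝ] WithLp 2 (E × E) :=
    { toFun := fun p => WithLp.toLp 2 (pairRotation θ p.ofLp)
      map_add' := fun p q => by
        simp only [pairRotation, ← WithLp.toLp_add, WithLp.ofLp_add, Prod.fst_add, Prod.snd_add,
          Prod.mk_add_mk, smul_add]
        congr 2 <;> abel
      map_smul' := fun c p => by
        simp only [pairRotation, ← WithLp.toLp_smul, WithLp.ofLp_smul, Prod.smul_fst,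
          Prod.smul_snd, Prod.smul_mk, smul_add, RingHom.id_apply]
        congr 2 <;> simp only [smul_comm c] }
  let e : WithLp 2 (E × E) →ₗᵢ[ℝ] WithLp 2 (E × E) := ⟨L, fun p => by
    rw [← sq_eq_sq₀ (norm_nonneg _) (norm_nonneg _), WithLp.prod_norm_sq_eq_of_L2,
      WithLp.prod_norm_sq_eq_of_L2]
    exact norm_sq_pairRotation θ p.ofLp⟩
  exact (WithLp.volume_preserving_ofLp E E).comp
    ((e.toLinearIsometryEquiv rfl).measurePreserving.comp (WithLp.volume_preserving_toLp E E))

lemma gaussianVolume_prod : (gaussianVolume E).prod (gaussianVolume E)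
    = (volume : Measure (E × E)).withDensity
      fun p => ENNReal.ofReal (Real.exp (-(‖p.1‖ ^ 2 + ‖p.2‖ ^ 2))) := by
  rw [gaussianVolume, prod_withDensity (by fun_prop) (by fun_prop)]
  congr 1
  funext p
  rw [← ENNReal.ofReal_mul (Real.exp_nonneg _), ← Real.exp_add]
  ring_nf

lemma lintegral_pairRotation (θ : ℝ) {Φ : E × E → ℝ≥0∞} (hΦ : Measurable Φ) :
    ∫⁻ p, Φ (pairRotation θ p) ∂(gaussianVolume E).prod (gaussianVolume E)
      = ∫⁻ p, Φ p ∂(gaussianVolume E).prod (gaussianVolume E) := by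
  have hmeas : Measurable (pairRotation θ : E × E → E × E) :=
    (measurePreserving_pairRotation_volume θ).measurable
  have hcomp := lintegral_withDensity_eq_lintegral_mul (volume : Measure (E × E))
    (f := fun p : E × E => ENNReal.ofReal (Real.exp (-(‖p.1‖ ^ 2 + ‖p.2‖ ^ 2))))
    (by fun_prop) (hΦ.comp hmeas)
  simp only [Function.comp_apply] at hcomp
  rw [gaussianVolume_prod, lintegral_withDensity_eq_lintegral_mul _ (by fun_prop) hΦ, hcomp,
    ← (measurePreserving_pairRotation_volume θ).lintegral_comp
      (f := (fun p : E × E => ENNReal.ofReal (Real.exp (-(‖p.1‖ ^ 2 + ‖p.2‖ ^ 2)))) * Φ)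
      (.mul (by fun_prop) hΦ)]
  simp only [Pi.mul_apply, norm_sq_pairRotation, Function.comp_apply]

lemma lintegral_circle_average {Φ : E × E → ℝ≥0∞} (hΦ : Measurable Φ) [Nontrivial E] :
    ∫⁻ p, (∫⁻ θ in Ioc 0 (2 * Real.pi), Φ (pairRotation θ p))
        ∂(gaussianVolume E).prod (gaussianVolume E)
      = ENNReal.ofReal (2 * Real.pi)
        * ∫⁻ p, Φ p ∂(gaussianVolume E).prod (gaussianVolume E) := by
  rw [lintegral_lintegral_swap]
  · simp_rw [lintegral_pairRotation _ hΦ]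
    rw [setLIntegral_const, Real.volume_Ioc, sub_zero, mul_comm]
  · exact (hΦ.comp (continuous_pairRotation.measurable.comp measurable_swap)).aemeasurable

lemma ae_pairRotation_fst_ne_zero (hE : 2 ≤ Module.finrank ℝ E) [Nontrivial E] :
    ∀ᵐ p ∂(gaussianVolume E).prod (gaussianVolume E), ∀ θ, (pairRotation θ p).1 ≠ 0 := by
  have hx : ∀ᵐ x ∂gaussianVolume E, x ≠ 0 := by
    simpa [ae_iff] using gaussianVolume_singleton (0 : E)
  have hy : ∀ x : E, ∀ᵐ y ∂gaussianVolume E, y ∉ ℝ ∙ x := fun x => by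
    have hac : gaussianVolume E ≪ volume := withDensity_absolutelyContinuous _ _
    refine hac.ae_le ?_
    have : (ℝ ∙ x) ≠ ⊤ := fun h => by
      have h1 := finrank_span_le_card (R := ℝ) ({x} : Set E)
      rw [h, finrank_top] at h1
      simp at h1
      lia
    exact measure_eq_zero_iff_ae_notMem.1 (Measure.addHaar_submodule volume _ this)
  have hmem : ∀ᵐ p ∂(gaussianVolume E).prod (gaussianVolume E),
      p ∈ {p : E × E | ⟪p.1, p.2⟫ ^ 2 ≠ (‖p.1‖ * ‖p.2‖) ^ 2} := by
    rw [Measure.ae_prod_mem_iff_ae_ae_mem]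
    · filter_upwards [hx] with x hx0
      filter_upwards [hy x] with y hxy h
      have hy0 : y ≠ 0 := fun h0 => hxy (h0 ▸ Submodule.zero_mem _)
      rw [sq_eq_sq_iff_abs_eq_abs, abs_of_nonneg (by positivity : 0 ≤ ‖x‖ * ‖y‖),
        ← Real.norm_eq_abs] at h
      obtain ⟨r, -, rfl⟩ := (norm_inner_eq_norm_iff hx0 hy0).1 h
      exact hxy (Submodule.smul_mem _ _ (Submodule.mem_span_singleton_self x))
    · exact (isOpen_ne_fun (by fun_prop) (by fun_prop)).measurableSet
  filter_upwards [hmem] with p hp θ h0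
  have h1 : p.1 = -Real.sin θ • (pairRotation θ p).2 := by
    simp only [pairRotation] at h0 ⊢
    linear_combination (norm := module) Real.cos θ • h0 - Real.sin_sq_add_cos_sq θ • p.1
  have h2 : p.2 = Real.cos θ • (pairRotation θ p).2 := by
    simp only [pairRotation] at h0 ⊢
    linear_combination (norm := module) Real.sin θ • h0 - Real.sin_sq_add_cos_sq θ • p.2
  refine hp ?_
  rw [h1, h2, real_inner_smul_left, real_inner_smul_right, real_inner_self_eq_norm_sq, norm_smul,
    norm_smul]
  simp only [mul_pow, Real.norm_eq_abs, sq_abs]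
  ring

lemma lintegral_sq_sub_le (hE : 2 ≤ Module.finrank ℝ E) {F : E → ℝ} {G : E → E}
    (hF : Measurable F) (hG : Measurable G) (hGc : ContinuousOn G {0}ᶜ)
    (hFG : ∀ x ≠ 0, HasFDerivAt F (innerSL ℝ (G x)) x) :
    ∫⁻ p : E × E, ENNReal.ofReal ((F p.2 - F p.1) ^ 2)
        ∂(gaussianVolume E).prod (gaussianVolume E)
      ≤ 2 * ∫⁻ p : E × E, ENNReal.ofReal (⟪G p.1, p.2⟫ ^ 2)
        ∂(gaussianVolume E).prod (gaussianVolume E) := by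
  have : Nontrivial E := Module.nontrivial_of_finrank_pos (R := ℝ) (by lia)
  have hΦ : Measurable fun p : E × E => ENNReal.ofReal ((F p.2 - F p.1) ^ 2) := by fun_prop
  have hΨ : Measurable fun p : E × E => ENNReal.ofReal (⟪G p.1, p.2⟫ ^ 2) := by fun_prop
  have hpi : ENNReal.ofReal (2 * Real.pi) ≠ 0 := by simp [Real.pi_pos]
  rw [← ENNReal.mul_le_mul_iff_right hpi ENNReal.ofReal_ne_top, mul_left_comm,
    ← lintegral_circle_average hΦ, ← lintegral_circle_average hΨ,
    ← lintegral_const_mul' _ _ (by simp)]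
  refine lintegral_mono_ae ?_
  filter_upwards [ae_pairRotation_fst_ne_zero hE] with p hp
  have hrot : ∀ θ, (pairRotation (θ + Real.pi / 2) p).1 = (pairRotation θ p).2 := fun θ => by
    simp [pairRotation, Real.cos_add_pi_div_two, Real.sin_add_pi_div_two]
  have hderiv : ∀ θ, HasDerivAt (fun θ => (pairRotation θ p).1) (pairRotation θ p).2 θ := fun θ =>
    ((Real.hasDerivAt_cos θ).smul_const p.1).add ((Real.hasDerivAt_sin θ).smul_const p.2)
  have hcont : Continuous fun θ => pairRotation θ p :=
    continuous_pairRotation.comp (by fun_prop : Continuous fun θ : ℝ => (θ, p))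
  have hGcont : Continuous fun θ => G (pairRotation θ p).1 :=
    hGc.comp_continuous hcont.fst fun θ => hp θ
  have hh : ∀ θ, HasDerivAt (fun θ => F (pairRotation θ p).1)
      ⟪G (pairRotation θ p).1, (pairRotation θ p).2⟫ θ := fun θ =>
    ((hFG _ (hp θ)).comp_hasDerivAt θ (hderiv θ) :)
  have hFcont : Continuous fun θ => F (pairRotation θ p).1 :=
    continuous_iff_continuousAt.2 fun θ => (hh θ).continuousAt
  have hFcont' : Continuous fun θ => F (pairRotation θ p).2 := by
    simp only [← hrot]
    exact hFcont.comp (by fun_prop : Continuous fun θ : ℝ => θ + Real.pi / 2)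
  have key := integral_sq_quarter_shift_le hh (hGcont.inner hcont.snd)
    (fun θ => by simp [pairRotation])
  simp only [hrot] at key
  rw [intervalIntegral.integral_of_le Real.two_pi_pos.le,
    intervalIntegral.integral_of_le Real.two_pi_pos.le] at key
  have hgInt : ∀ g : ℝ → ℝ, Continuous g → IntegrableOn g (Ioc 0 (2 * Real.pi)) := fun g hg =>
    hg.integrableOn_Ioc
  have h1 := ofReal_integral_eq_lintegral_ofReal (hgInt _ ((hFcont'.sub hFcont).pow 2))
    (.of_forall fun _ => sq_nonneg _)
  have h2 := ofReal_integral_eq_lintegral_ofReal (hgInt _ ((hGcont.inner hcont.snd).pow 2))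
    (.of_forall fun _ => sq_nonneg _)
  simp only [Pi.pow_apply, Pi.sub_apply] at h1 h2
  rw [← h1, ← h2, ← ENNReal.ofReal_ofNat 2, ← ENNReal.ofReal_mul (by norm_num)]
  exact ENNReal.ofReal_le_ofReal key

end Poincare

section SphericalPoincare

variable {n : ℕ}

local notation "𝔼" => EuclideanSpace ℝ (Fin n)

lemma ContDiff.continuous_gradient {φ : 𝔼 → ℝ} (hφ : ContDiff ℝ 1 φ) : Continuous (gradient φ) :=
  (LinearIsometryEquiv.continuous _).comp (hφ.continuous_fderiv one_ne_zero)

lemma ContDiff.continuous_sphGrad {φ : 𝔼 → ℝ} (hφ : ContDiff ℝ 1 φ) : Continuous (sphGrad φ) := by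
  have := hφ.continuous_gradient
  unfold sphGrad
  fun_prop

lemma sphGrad_sub_const (φ : 𝔼 → ℝ) (c : ℝ) (u : 𝔼) :
    sphGrad (fun x => φ x - c) u = sphGrad φ u := by
  simp only [sphGrad, gradient, fderiv_sub_const]

/-- The gradient of the one-homogeneous extension of `φ`, at a point of direction `u`. -/
def homogeneousGrad (φ : 𝔼 → ℝ) (u : 𝔼) : 𝔼 := φ u • u + sphGrad φ u

lemma norm_sq_homogeneousGrad (φ : 𝔼 → ℝ) {u : 𝔼} (hu : ‖u‖ = 1) :
    ‖homogeneousGrad φ u‖ ^ 2 = φ u ^ 2 + ‖sphGrad φ u‖ ^ 2 := by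
  have h0 : ⟪u, sphGrad φ u⟫ = 0 := by
    simp [sphGrad, inner_sub_right, real_inner_smul_right, hu]
  rw [homogeneousGrad, norm_add_sq_real, real_inner_smul_left, h0, norm_smul, hu]
  simp

lemma hasFDerivAt_homogeneous {φ : 𝔼 → ℝ} (hφ : ContDiff ℝ 1 φ) {x : 𝔼} (hx : x ≠ 0) :
    HasFDerivAt (fun x => ‖x‖ * φ (‖x‖⁻¹ • x))
      (innerSL ℝ (homogeneousGrad φ (‖x‖⁻¹ • x))) x := by
  have hx' : ‖x‖ ≠ 0 := norm_ne_zero_iff.2 hx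
  have hnorm : HasFDerivAt (fun x : 𝔼 => ‖x‖) (‖x‖⁻¹ • innerSL ℝ x) x := by
    have h := (hasStrictFDerivAt_norm_sq x).hasFDerivAt.sqrt (pow_ne_zero 2 hx')
    simp only [Real.sqrt_sq (norm_nonneg _)] at h
    refine h.congr_fderiv ?_
    ext v
    simp
    field_simp
  have hinv : HasFDerivAt (fun x : 𝔼 => ‖x‖⁻¹) (-(‖x‖ ^ 2)⁻¹ • ‖x‖⁻¹ • innerSL ℝ x) x :=
    (hasDerivAt_inv hx').comp_hasFDerivAt x hnorm
  have hu : HasFDerivAt (fun x : 𝔼 => ‖x‖⁻¹ • x) _ x := hinv.smul (hasFDerivAt_id x)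
  have hgrad := ((hφ.differentiable one_ne_zero).differentiableAt
    (x := ‖x‖⁻¹ • x)).hasGradientAt.hasFDerivAt
  refine (hnorm.mul (hgrad.comp (f := fun x : 𝔼 => ‖x‖⁻¹ • x) x hu)).congr_fderiv ?_
  ext v
  simp [homogeneousGrad, sphGrad]
  field_simp
  ring

lemma continuousOn_inv_norm_smul : ContinuousOn (fun x : 𝔼 => ‖x‖⁻¹ • x) {0}ᶜ :=
  (continuousOn_id.norm.inv₀ fun _ hx => norm_ne_zero_iff.2 hx).smul continuousOn_id

lemma exists_bound_direction {F : Type*} [NormedAddCommGroup F] {g : 𝔼 → F} (hg : Continuous g) :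
    ∃ C, ∀ x, ‖g (‖x‖⁻¹ • x)‖ ≤ C := by
  obtain ⟨C, hC⟩ := (isCompact_closedBall (0 : 𝔼) 1).exists_bound_of_continuousOn hg.continuousOn
  refine ⟨C, fun x => hC _ ?_⟩
  rw [mem_closedBall_zero_iff, norm_smul, norm_inv, norm_norm]
  exact inv_mul_le_one

/-- **The sharp Poincaré inequality on the sphere** for functions of mean zero. -/
lemma sphere_poincare_of_integral_eq_zero (hn : 2 ≤ n) {φ : 𝔼 → ℝ} (hφ : ContDiff ℝ 1 φ)
    (hmean : ∫ u : sphere (0 : 𝔼) 1, φ u ∂(volume : Measure 𝔼).toSphere = 0) :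
    ((n : ℝ) - 1) * ∫ u : sphere (0 : 𝔼) 1, φ u ^ 2 ∂(volume : Measure 𝔼).toSphere
      ≤ ∫ u : sphere (0 : 𝔼) 1, ‖sphGrad φ u‖ ^ 2 ∂(volume : Measure 𝔼).toSphere := by
  have hdim : Module.finrank ℝ 𝔼 = n := by simp
  have : Nontrivial 𝔼 := Module.nontrivial_of_finrank_pos (R := ℝ) (by rw [hdim]; lia)
  set μ := gaussianVolume 𝔼
  set σ := (volume : Measure 𝔼).toSphere
  set F : 𝔼 → ℝ := fun x => ‖x‖ * φ (‖x‖⁻¹ • x) with hFdef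
  set G : 𝔼 → 𝔼 := fun x => homogeneousGrad φ (‖x‖⁻¹ • x)
  have hgc : Continuous (homogeneousGrad φ) :=
    (hφ.continuous.smul continuous_id).add hφ.continuous_sphGrad
  have hdir : Measurable fun x : 𝔼 => ‖x‖⁻¹ • x := by fun_prop
  have hF : Measurable F := measurable_norm.mul (hφ.continuous.measurable.comp hdir)
  have hG : Measurable G := hgc.measurable.comp hdir
  obtain ⟨C, hC⟩ := exists_bound_direction hφ.continuous
  obtain ⟨D, hD⟩ := exists_bound_direction hgc
  have hD0 : 0 ≤ D := (norm_nonneg _).trans (hD 0)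
  -- integrability
  have hnorm1 : Integrable (fun x : 𝔼 => ‖x‖) μ := by
    simpa using integrable_gaussianVolume_norm_pow (E := 𝔼) 1
  have hnorm2 : Integrable (fun x : 𝔼 => ‖x‖ ^ 2) μ := integrable_gaussianVolume_norm_pow 2
  have hFint : Integrable F μ := by
    refine (hnorm1.const_mul C).mono' hF.aestronglyMeasurable (.of_forall fun x => ?_)
    rw [hFdef, norm_mul, norm_norm, mul_comm]
    gcongr
    exact hC x
  have hF2int : Integrable (fun x => F x ^ 2) μ := by
    refine (hnorm2.const_mul (C ^ 2)).mono' (by fun_prop) (.of_forall fun x => ?_)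
    rw [hFdef, norm_pow, norm_mul, norm_norm, mul_comm, mul_pow]
    gcongr
    exact hC x
  have hGint : Integrable (fun p : 𝔼 × 𝔼 => ⟪G p.1, p.2⟫ ^ 2) (μ.prod μ) := by
    refine ((hnorm2.comp_snd μ).const_mul (D ^ 2)).mono' (by fun_prop) (.of_forall fun p => ?_)
    rw [norm_pow, ← mul_pow]
    gcongr
    exact (abs_real_inner_le_norm _ _).trans (by gcongr; exact hD _)
  have hcross : Integrable (fun p : 𝔼 × 𝔼 => F p.1 * F p.2) (μ.prod μ) := hFint.mul_prod hFint
  have hsub : Integrable (fun p : 𝔼 × 𝔼 => (F p.2 - F p.1) ^ 2) (μ.prod μ) := by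
    refine (((hF2int.comp_snd μ).add (hF2int.comp_fst μ)).sub (hcross.const_mul 2)).congr
      (.of_forall fun p => ?_)
    simp only [Pi.add_apply, Pi.sub_apply]
    ring
  -- the Gaussian inequality
  have key : ∫ p : 𝔼 × 𝔼, (F p.2 - F p.1) ^ 2 ∂μ.prod μ
      ≤ 2 * ∫ p : 𝔼 × 𝔼, ⟪G p.1, p.2⟫ ^ 2 ∂μ.prod μ := by
    have two_mul_ofReal (X : ℝ) : ENNReal.ofReal (2 * X) = 2 * ENNReal.ofReal X := by
      rw [ENNReal.ofReal_mul zero_le_two, ENNReal.ofReal_ofNat]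
    have h := lintegral_sq_sub_le (by rw [hdim]; exact hn) hF hG
      (hgc.comp_continuousOn continuousOn_inv_norm_smul)
      fun x hx => hasFDerivAt_homogeneous hφ hx
    rw [← ofReal_integral_eq_lintegral_ofReal hsub (.of_forall fun _ => sq_nonneg _),
      ← ofReal_integral_eq_lintegral_ofReal hGint (.of_forall fun _ => sq_nonneg _),
      ← two_mul_ofReal] at h
    exact (ENNReal.ofReal_le_ofReal_iff
      (mul_nonneg zero_le_two (integral_nonneg fun _ => sq_nonneg _))).1 h
  -- polar coordinates
  have hFmean : ∫ x, F x ∂μ = 0 := by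
    have h := integral_gaussianVolume_homogeneous 1 φ
    rw [hmean, mul_zero] at h
    simpa only [pow_one] using h
  have hF2 : ∫ x, F x ^ 2 ∂μ = gaussianRadialMoment 𝔼 2 * ∫ u : sphere (0 : 𝔼) 1, φ u ^ 2 ∂σ := by
    have := integral_gaussianVolume_homogeneous 2 fun u => φ u ^ 2
    simpa only [hFdef, mul_pow] using this
  have hG2 : ∫ x, ‖G x‖ ^ 2 ∂μ = gaussianRadialMoment 𝔼 0
      * (∫ u : sphere (0 : 𝔼) 1, φ u ^ 2 ∂σ + ∫ u : sphere (0 : 𝔼) 1, ‖sphGrad φ u‖ ^ 2 ∂σ) := by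
    have h := integral_gaussianVolume_homogeneous 0 fun u => ‖homogeneousGrad φ u‖ ^ 2
    simp only [pow_zero, one_mul] at h
    rw [h, ← integral_add]
    · congr 1
      exact integral_congr_ae (.of_forall fun u => norm_sq_homogeneousGrad φ (by simp))
    · exact (((hφ.continuous.comp continuous_subtype_val).pow 2).integrable_of_hasCompactSupport
        (.of_compactSpace _))
    · exact (((hφ.continuous_sphGrad.comp continuous_subtype_val).norm.pow
        2).integrable_of_hasCompactSupport (.of_compactSpace _))
  have hM0 : μ.real univ = gaussianRadialMoment 𝔼 0 * σ.real univ := by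
    have h := integral_gaussianVolume_homogeneous 0 (fun _ : 𝔼 => (1 : ℝ))
    simp only [pow_zero, mul_one, integral_const, smul_eq_mul] at h
    exact h
  have hM2 : ∫ x : 𝔼, ‖x‖ ^ 2 ∂μ = gaussianRadialMoment 𝔼 2 * σ.real univ := by
    have h := integral_gaussianVolume_homogeneous 2 (fun _ : 𝔼 => (1 : ℝ))
    simp only [mul_one, integral_const, smul_eq_mul] at h
    exact h
  have hL : ∫ p : 𝔼 × 𝔼, (F p.2 - F p.1) ^ 2 ∂μ.prod μ
      = 2 * (μ.real univ * ∫ x, F x ^ 2 ∂μ) := by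
    have e : ∀ p : 𝔼 × 𝔼, (F p.2 - F p.1) ^ 2 = F p.2 ^ 2 + F p.1 ^ 2 - 2 * (F p.1 * F p.2) :=
      fun p => by ring
    simp only [e]
    have hadd : Integrable (fun p : 𝔼 × 𝔼 => F p.2 ^ 2 + F p.1 ^ 2) (μ.prod μ) :=
      (hF2int.comp_snd μ).add (hF2int.comp_fst μ)
    rw [integral_sub hadd (hcross.const_mul 2),
      integral_add (hF2int.comp_snd μ) (hF2int.comp_fst μ), integral_const_mul,
      integral_prod_mul, hFmean, integral_fun_snd (fun y => F y ^ 2),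
      integral_fun_fst (fun y => F y ^ 2)]
    simp only [smul_eq_mul]
    ring
  have hR : n * ∫ p : 𝔼 × 𝔼, ⟪G p.1, p.2⟫ ^ 2 ∂μ.prod μ
      = (∫ x, ‖G x‖ ^ 2 ∂μ) * ∫ x : 𝔼, ‖x‖ ^ 2 ∂μ := by
    rw [integral_prod _ hGint, ← integral_const_mul, ← integral_mul_const]
    refine integral_congr_ae (.of_forall fun x => ?_)
    have := integral_gaussianVolume_inner_sq (G x)
    rwa [hdim] at this
  have hK0 := gaussianRadialMoment_pos (E := 𝔼) 0
  have hK2 := gaussianRadialMoment_pos (E := 𝔼) 2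
  have hS : 0 < σ.real univ := ENNReal.toReal_pos
    (Measure.measure_univ_ne_zero.2 (Measure.toSphere_ne_zero _)) (measure_ne_top _ _)
  have hn0 : (0 : ℝ) < n := by exact_mod_cast (by lia : 0 < n)
  have final := mul_le_mul_of_nonneg_left key hn0.le
  rw [hL, mul_left_comm (n : ℝ) 2 (∫ p : 𝔼 × 𝔼, ⟪G p.1, p.2⟫ ^ 2 ∂μ.prod μ), hR, hM0, hF2, hG2,
    hM2] at final
  have hpos : 0 < 2 * gaussianRadialMoment 𝔼 0 * gaussianRadialMoment 𝔼 2 * σ.real univ := by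
    positivity
  refine le_of_mul_le_mul_left ?_ hpos
  linarith

/-- **The sharp Poincaré inequality on the sphere**, together with the Cauchy-Schwarz inequality
between the mean and the square mean. -/
lemma sphere_poincare (hn : 2 ≤ n) {ψ : 𝔼 → ℝ} (hψ : ContDiff ℝ 1 ψ) :
    (∫ u : sphere (0 : 𝔼) 1, ψ u ∂(volume : Measure 𝔼).toSphere) ^ 2
          / ((volume : Measure 𝔼).toSphere univ).toReal
        ≤ ∫ u : sphere (0 : 𝔼) 1, ψ u ^ 2 ∂(volume : Measure 𝔼).toSphere ∧
      ((n : ℝ) - 1) * (∫ u : sphere (0 : 𝔼) 1, ψ u ^ 2 ∂(volume : Measure 𝔼).toSphere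
          - (∫ u : sphere (0 : 𝔼) 1, ψ u ∂(volume : Measure 𝔼).toSphere) ^ 2
            / ((volume : Measure 𝔼).toSphere univ).toReal)
        ≤ ∫ u : sphere (0 : 𝔼) 1, ‖sphGrad ψ u‖ ^ 2 ∂(volume : Measure 𝔼).toSphere := by
  have hdim : Module.finrank ℝ 𝔼 = n := by simp
  have : Nontrivial 𝔼 := Module.nontrivial_of_finrank_pos (R := ℝ) (by rw [hdim]; lia)
  set σ := (volume : Measure 𝔼).toSphere
  have hS : 0 < (σ univ).toReal := ENNReal.toReal_pos
    (Measure.measure_univ_ne_zero.2 (Measure.toSphere_ne_zero _)) (measure_ne_top _ _)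
  set S := (σ univ).toReal
  set I := ∫ u : sphere (0 : 𝔼) 1, ψ u ∂σ
  have hcont : Continuous fun u : sphere (0 : 𝔼) 1 => ψ u :=
    hψ.continuous.comp continuous_subtype_val
  have hψInt : Integrable (fun u : sphere (0 : 𝔼) 1 => ψ u) σ :=
    hcont.integrable_of_hasCompactSupport (.of_compactSpace _)
  have hψ2Int : Integrable (fun u : sphere (0 : 𝔼) 1 => ψ u ^ 2) σ :=
    (hcont.pow 2).integrable_of_hasCompactSupport (.of_compactSpace _)
  have hconst (c : ℝ) : ∫ _ : sphere (0 : 𝔼) 1, c ∂σ = S * c := by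
    rw [integral_const, smul_eq_mul, measureReal_def]
  have hmean : ∫ u : sphere (0 : 𝔼) 1, (ψ u - I / S) ∂σ = 0 := by
    rw [integral_sub hψInt (integrable_const _), hconst, mul_div_cancel₀ _ hS.ne', sub_self]
  have hvar : ∫ u : sphere (0 : 𝔼) 1, (ψ u - I / S) ^ 2 ∂σ
      = ∫ u : sphere (0 : 𝔼) 1, ψ u ^ 2 ∂σ - I ^ 2 / S := by
    have e : ∀ u : sphere (0 : 𝔼) 1,
        (ψ u - I / S) ^ 2 = ψ u ^ 2 - 2 * (I / S) * (ψ u - I / S) - (I / S) ^ 2 := fun u => by ring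
    have hdev : Integrable (fun u : sphere (0 : 𝔼) 1 => 2 * (I / S) * (ψ u - I / S)) σ :=
      (hψInt.sub (integrable_const _)).const_mul _
    simp only [e]
    have hdiff : Integrable
        (fun u : sphere (0 : 𝔼) 1 => ψ u ^ 2 - 2 * (I / S) * (ψ u - I / S)) σ := hψ2Int.sub hdev
    rw [integral_sub hdiff (integrable_const _), integral_sub hψ2Int hdev,
      integral_const_mul, hmean, hconst]
    field_simp
    ring
  have h := sphere_poincare_of_integral_eq_zero hn (hψ.sub (contDiff_const (c := I / S))) hmean
  simp only [sphGrad_sub_const] at h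
  rw [hvar] at h
  exact ⟨sub_nonneg.1 (hvar ▸ integral_nonneg fun _ => sq_nonneg _), h⟩

end SphericalPoincare

section LogConcaveProfile

lemma add_mul_integral_pow_mul_exp_le (n : ℕ) (hn : 1 ≤ n) {c : ℝ} (hc : c ≤ 0) :
    (n + c) * ∫ t in (0 : ℝ)..1, t ^ (n - 1) * Real.exp (c * (t - 1)) ≤ 1 := by
  have hd (t : ℝ) : HasDerivAt (fun t : ℝ => t ^ n * Real.exp (c * (t - 1)))
      ((n + c * t) * (t ^ (n - 1) * Real.exp (c * (t - 1)))) t := by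
    refine ((hasDerivAt_pow n t).mul
      (((hasDerivAt_id t).sub_const 1).const_mul c).exp).congr_deriv ?_
    rw [← pow_sub_one_mul (by lia : n ≠ 0) t]
    simp only [id]
    ring
  have hftc := intervalIntegral.integral_eq_sub_of_hasDerivAt (a := 0) (b := 1)
    (fun t _ => hd t) (Continuous.intervalIntegrable (by fun_prop) _ _)
  rw [← intervalIntegral.integral_const_mul]
  calc _ ≤ ∫ t in (0 : ℝ)..1, (n + c * t) * (t ^ (n - 1) * Real.exp (c * (t - 1))) := by
        refine intervalIntegral.integral_mono_on zero_le_one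
          (Continuous.intervalIntegrable (by fun_prop) _ _)
          (Continuous.intervalIntegrable (by fun_prop) _ _) fun t ht => ?_
        refine mul_le_mul_of_nonneg_right ?_ (mul_nonneg (pow_nonneg ht.1 _) (Real.exp_nonneg _))
        nlinarith [ht.2]
    _ = 1 := by simp [hftc, (by lia : n ≠ 0)]

lemma le_mul_exp_of_logConcave {f : ℝ → ℝ} {d a R : ℝ} (hd : HasDerivAt f d R) (hR : 0 < f R)
    (ha : 0 ≤ f a)
    (hf : ∀ l ∈ Icc (0 : ℝ) 1, f a ^ l * f R ^ (1 - l) ≤ f (l * a + (1 - l) * R)) :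
    f a ≤ f R * Real.exp (d / f R * (a - R)) := by
  rcases ha.eq_or_lt with ha | ha
  · rw [← ha]; positivity
  have hlin : HasDerivAt (fun l : ℝ => l * a + (1 - l) * R) (a - R) 0 := by
    refine (((hasDerivAt_id (0 : ℝ)).mul_const a).add
      (((hasDerivAt_id (0 : ℝ)).const_sub 1).mul_const R)).congr_deriv ?_
    ring
  have hcomp : HasDerivAt (fun l : ℝ => f (l * a + (1 - l) * R)) (d * (a - R)) 0 :=
    HasDerivAt.comp (h₂ := f) (0 : ℝ) (by simpa using hd) hlin
  have hpow : HasDerivAt (fun l : ℝ => f a ^ l * f R ^ (1 - l))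
      (f R * (Real.log (f a) - Real.log (f R))) 0 := by
    have h1 := (hasDerivAt_id (0 : ℝ)).const_rpow ha
    have h2 := ((hasDerivAt_id (0 : ℝ)).const_sub 1).const_rpow hR
    refine (h1.mul h2).congr_deriv ?_
    simp
    ring
  have hle : f R * (Real.log (f a) - Real.log (f R)) ≤ d * (a - R) := by
    have hsub := hcomp.sub hpow
    have hmin : IsLocalMinOn (fun l : ℝ => f (l * a + (1 - l) * R) - f a ^ l * f R ^ (1 - l))
        (Icc 0 1) 0 := by
      filter_upwards [self_mem_nhdsWithin] with l hl
      simpa using hf l hl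
    have hcone : (1 : ℝ) ∈ posTangentConeAt (Icc (0 : ℝ) 1) 0 :=
      mem_posTangentConeAt_of_segment_subset (by simp [segment_eq_Icc])
    simpa using hmin.hasFDerivWithinAt_nonneg hsub.hasFDerivAt.hasFDerivWithinAt hcone
  have : Real.log (f a) ≤ Real.log (f R) + d / f R * (a - R) := by
    rw [div_mul_eq_mul_div, ← sub_le_iff_le_add', le_div_iff₀ hR]
    linarith
  calc f a = Real.exp (Real.log (f a)) := (Real.exp_log ha).symm
    _ ≤ _ := Real.exp_le_exp.2 this
    _ = _ := by rw [Real.exp_add, Real.exp_log hR]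

/-- The combination of the two lower bounds on `f R` that monotonicity and log-concavity give in
terms of `∫₀¹ t^(n-1) f(Rt) dt`. -/
lemma integral_profile_mul_le {n : ℕ} (hn : 1 ≤ n) {f : ℝ → ℝ} {d R : ℝ} (hR : 0 < R)
    (hd : HasDerivAt f d R) (hd0 : d ≤ 0) (hcont : ContinuousOn f (Ici 0))
    (hpos : ∀ t ∈ Ici (0 : ℝ), 0 ≤ f t) (hmono : AntitoneOn f (Ici 0))
    (hf : ∀ a ∈ Ici (0 : ℝ), ∀ l ∈ Icc (0 : ℝ) 1,
      f a ^ l * f R ^ (1 - l) ≤ f (l * a + (1 - l) * R)) :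
    (∫ t in (0 : ℝ)..1, t ^ (n - 1) * f (R * t)) * ((n - 1) * f R + R * d)
      ≤ (n - 1) / n * f R ^ 2 := by
  have hn0 : (0 : ℝ) < n := by exact_mod_cast hn
  have hn1 : (1 : ℝ) ≤ n := by exact_mod_cast hn
  set A := ∫ t in (0 : ℝ)..1, t ^ (n - 1) * f (R * t)
  have hmem {t : ℝ} (ht : t ∈ Icc (0 : ℝ) 1) : R * t ∈ Ici (0 : ℝ) := mul_nonneg hR.le ht.1
  have hprodInt : IntervalIntegrable (fun t => t ^ (n - 1) * f (R * t)) volume 0 1 := by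
    refine ContinuousOn.intervalIntegrable ?_
    rw [uIcc_of_le zero_le_one]
    exact (by fun_prop : Continuous fun t : ℝ => t ^ (n - 1)).continuousOn.mul
      (hcont.comp (by fun_prop) fun t ht => hmem ht)
  have hA0 : 0 ≤ A := intervalIntegral.integral_nonneg zero_le_one fun t ht =>
    mul_nonneg (pow_nonneg ht.1 _) (hpos _ (hmem ht))
  have hlow : f R / n ≤ A := by
    calc f R / n = ∫ t in (0 : ℝ)..1, t ^ (n - 1) * f R := by
          rw [intervalIntegral.integral_mul_const, integral_pow]
          simp [Nat.sub_add_cancel hn, hn, Nat.cast_sub, div_eq_inv_mul, (by lia : n ≠ 0)]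
      _ ≤ A := by
          refine intervalIntegral.integral_mono_on zero_le_one
            (Continuous.intervalIntegrable (by fun_prop) _ _) hprodInt fun t ht => ?_
          exact mul_le_mul_of_nonneg_left (hmono (hmem ht) hR.le (by nlinarith [ht.2]))
            (pow_nonneg ht.1 _)
  have hRd : R * d ≤ 0 := mul_nonpos_of_nonneg_of_nonpos hR.le hd0
  rcases (hpos R hR.le).eq_or_lt with h0 | h0
  · rw [← h0]
    nlinarith
  have hup : A * (n * f R + R * d) ≤ f R ^ 2 := by
    rcases le_total (n * f R + R * d) 0 with hneg | hnn
    · exact (mul_nonpos_of_nonneg_of_nonpos hA0 hneg).trans (sq_nonneg _)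
    set c := R * d / f R with hc
    have hcR : c * f R = R * d := div_mul_cancel₀ _ h0.ne'
    have hAle : A ≤ f R * ∫ t in (0 : ℝ)..1, t ^ (n - 1) * Real.exp (c * (t - 1)) := by
      rw [← intervalIntegral.integral_const_mul]
      refine intervalIntegral.integral_mono_on zero_le_one hprodInt
        (Continuous.intervalIntegrable (by fun_prop) _ _) fun t ht => ?_
      rw [mul_left_comm]
      refine mul_le_mul_of_nonneg_left ?_ (pow_nonneg ht.1 _)
      have := le_mul_exp_of_logConcave hd h0 (hpos _ (hmem ht)) (hf _ (hmem ht))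
      rwa [(by rw [hc]; ring : c * (t - 1) = d / f R * (R * t - R))]
    have hexp := add_mul_integral_pow_mul_exp_le n hn (div_nonpos_of_nonpos_of_nonneg hRd h0.le)
    calc A * (n * f R + R * d)
        ≤ (f R * ∫ t in (0 : ℝ)..1, t ^ (n - 1) * Real.exp (c * (t - 1))) * (n * f R + R * d) :=
          mul_le_mul_of_nonneg_right hAle hnn
      _ = f R ^ 2 * ((n + c) * ∫ t in (0 : ℝ)..1, t ^ (n - 1) * Real.exp (c * (t - 1))) := by
          rw [← hcR]; ring
      _ ≤ f R ^ 2 := mul_le_of_le_one_right (sq_nonneg _) hexp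
  have hsplit : (n - 1) / n * f R ^ 2 = f R ^ 2 - f R / n * f R := by
    field_simp
  rw [hsplit]
  nlinarith [mul_le_mul_of_nonneg_right hlow h0.le]

end LogConcaveProfile

/-- **Validity of the infinitesimal dimensional Brunn-Minkowski inequality at a ball.**
If `f ∈ C²([0,∞))` is such that `x ↦ f(|x|)` is a log-concave density on `ℝⁿ`
(in particular `f` is non-increasing), `R > 0` and `A = ∫₀¹ t^(n-1) f(Rt) dt`, then
for every `ψ ∈ C²(𝕊ⁿ⁻¹)`:
`(A f(R)/|𝕊ⁿ⁻¹|)((n-1)∫ψ² - ∫|∇_σψ|²) + (A R f'(R)/|𝕊ⁿ⁻¹|)∫ψ²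
  ≤ ((n-1)/n) f(R)² ((1/|𝕊ⁿ⁻¹|)∫ψ)²`. -/
theorem infinitesimal_dim_BM_at_ball (n : ℕ) (hn : 2 ≤ n)
    (f : ℝ → ℝ) (hf : ContDiffOn ℝ 2 f (Ici 0)) (hfpos : ∀ t ∈ Ici (0:ℝ), 0 ≤ f t)
    (hlogconc : ∀ x y : EuclideanSpace ℝ (Fin n), ∀ l ∈ Icc (0:ℝ) 1,
      f ‖x‖ ^ l * f ‖y‖ ^ (1 - l) ≤ f ‖l • x + (1 - l) • y‖)
    (hdensity : ∫ x : EuclideanSpace ℝ (Fin n), f ‖x‖ = 1)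
    (hmono : AntitoneOn f (Ici 0))
    (R : ℝ) (hR : 0 < R)
    (A : ℝ) (hA : A = ∫ t in (0:ℝ)..1, t ^ (n - 1) * f (R * t))
    (ψ : EuclideanSpace ℝ (Fin n) → ℝ) (hψ : ContDiff ℝ 2 ψ) :
    A * f R / (((volume : Measure (EuclideanSpace ℝ (Fin n))).toSphere univ).toReal)
        * (((n:ℝ) - 1)
            * (∫ u : sphere (0 : EuclideanSpace ℝ (Fin n)) 1, (ψ ↑u) ^ 2
                ∂((volume : Measure (EuclideanSpace ℝ (Fin n))).toSphere))
          - ∫ u : sphere (0 : EuclideanSpace ℝ (Fin n)) 1, ‖sphGrad ψ ↑u‖ ^ 2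
                ∂((volume : Measure (EuclideanSpace ℝ (Fin n))).toSphere))
      + A * R * deriv f R
          / (((volume : Measure (EuclideanSpace ℝ (Fin n))).toSphere univ).toReal)
        * (∫ u : sphere (0 : EuclideanSpace ℝ (Fin n)) 1, (ψ ↑u) ^ 2
            ∂((volume : Measure (EuclideanSpace ℝ (Fin n))).toSphere))
    ≤ ((n:ℝ) - 1) / n * (f R) ^ 2
        * ((1 / (((volume : Measure (EuclideanSpace ℝ (Fin n))).toSphere univ).toReal))
            * ∫ u : sphere (0 : EuclideanSpace ℝ (Fin n)) 1, ψ ↑u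
                ∂((volume : Measure (EuclideanSpace ℝ (Fin n))).toSphere)) ^ 2 := by
  have hφ : ContDiff ℝ 1 ψ := hψ.of_le one_le_two
  have hn1 : 1 ≤ n := by lia
  have hdim : Module.finrank ℝ (EuclideanSpace ℝ (Fin n)) = n := by simp
  have : Nontrivial (EuclideanSpace ℝ (Fin n)) :=
    Module.nontrivial_of_finrank_pos (R := ℝ) (by rw [hdim]; lia)
  have hd : HasDerivAt f (deriv f R) R :=
    ((hf.contDiffAt (Ici_mem_nhds hR)).differentiableAt two_ne_zero).hasDerivAt
  have hd0 : deriv f R ≤ 0 := by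
    rw [← derivWithin_of_mem_nhds (Ici_mem_nhds hR)]
    exact hmono.derivWithin_nonpos
  obtain ⟨e, he⟩ := exists_norm_eq (EuclideanSpace ℝ (Fin n)) zero_le_one
  have hray {t : ℝ} (ht : 0 ≤ t) : ‖t • e‖ = t := by
    rw [norm_smul, he, mul_one, Real.norm_of_nonneg ht]
  have hprofile := integral_profile_mul_le hn1 hR hd hd0 hf.continuousOn hfpos hmono
    fun a ha l hl => by
      have h := hlogconc (a • e) (R • e) l hl
      rwa [smul_smul, smul_smul, ← add_smul, hray ha, hray hR.le,
        hray (add_nonneg (mul_nonneg hl.1 ha) (mul_nonneg (sub_nonneg.2 hl.2) hR.le))] at h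
  rw [← hA] at hprofile
  have hA0 : 0 ≤ A := by
    rw [hA]
    exact intervalIntegral.integral_nonneg zero_le_one fun t ht =>
      mul_nonneg (pow_nonneg ht.1 _) (hfpos _ (mul_nonneg hR.le ht.1))
  have hfR := hfpos R hR.le
  obtain ⟨hsq, hpoin⟩ := sphere_poincare hn hφ
  have hS : 0 < ((volume : Measure (EuclideanSpace ℝ (Fin n))).toSphere univ).toReal :=
    ENNReal.toReal_pos
      (Measure.measure_univ_ne_zero.2 (Measure.toSphere_ne_zero _)) (measure_ne_top _ _)
  generalize ((volume : Measure (EuclideanSpace ℝ (Fin n))).toSphere univ).toReal = S at *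
  generalize ∫ u : sphere (0 : EuclideanSpace ℝ (Fin n)) 1, ψ ↑u
    ∂((volume : Measure (EuclideanSpace ℝ (Fin n))).toSphere) = I at *
  generalize ∫ u : sphere (0 : EuclideanSpace ℝ (Fin n)) 1, (ψ ↑u) ^ 2
    ∂((volume : Measure (EuclideanSpace ℝ (Fin n))).toSphere) = P at *
  generalize ∫ u : sphere (0 : EuclideanSpace ℝ (Fin n)) 1, ‖sphGrad ψ ↑u‖ ^ 2
    ∂((volume : Measure (EuclideanSpace ℝ (Fin n))).toSphere) = Q at *
  have hm : I ^ 2 / S = S * (1 / S * I) ^ 2 := by field_simp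
  rw [hm] at hsq hpoin
  set m := 1 / S * I
  have h1 : A * f R / S * ((n - 1) * P - Q) ≤ A * f R / S * ((n - 1) * (S * m ^ 2)) :=
    mul_le_mul_of_nonneg_left (by linarith) (div_nonneg (mul_nonneg hA0 hfR) hS.le)
  have h2 : A * R * deriv f R / S * P ≤ A * R * deriv f R / S * (S * m ^ 2) :=
    mul_le_mul_of_nonpos_left hsq
      (div_nonpos_of_nonpos_of_nonneg (mul_nonpos_of_nonneg_of_nonpos (by positivity) hd0) hS.le)
  calc _ ≤ A * f R / S * ((n - 1) * (S * m ^ 2)) + A * R * deriv f R / S * (S * m ^ 2) :=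
        add_le_add h1 h2
    _ = A * ((n - 1) * f R + R * deriv f R) * m ^ 2 := by field_simp
    _ ≤ (n - 1) / n * f R ^ 2 * m ^ 2 := mul_le_mul_of_nonneg_right hprofile (sq_nonneg _)
end
end
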